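/- arXiv:2602.11840 — 2 statements merged into one kernel-verified Lean document; each statement's English description precedes it below -/
import Mathlib

section
/- Let w ≥ 1 and X, N be integers with X > 0 and N ≥ max(X, w + 1), and let G be a graph with treewidth at most w and 2N + X + w + 2 ≤ |G| ≤ 5N + X + 2w + 2. Then there exists a set S of exactly w + 1 vertices of G and a partition of G minus S into parts G_1, G_2, G_3 such that |G_1| ≤ 2N + X, |G_2| ≤ 2N + Δ(|G_1|), |G_3| ≤ 2N + Δ(|G_1| + |G_2|) + w + 1, and |G_1| + |G_2| ≥ 2N + X. -/
/-- `(T, B)` is a tree-decomposition of the graph `G`: `T` is a tree, every vertex of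
`G` lies in some bag, every edge of `G` has both endpoints in a common bag, and for
each vertex of `G` the set of tree-vertices whose bag contains it induces a connected
subgraph (subtree) of `T`. -/
def IsTreeDecomp {V ι : Type} (G : SimpleGraph V) (T : SimpleGraph ι)
    (B : ι → Finset V) : Prop :=
  T.IsTree ∧
  (∀ v : V, ∃ x : ι, v ∈ B x) ∧
  (∀ u v : V, G.Adj u v → ∃ x : ι, u ∈ B x ∧ v ∈ B x) ∧
  (∀ v : V, (T.induce {x : ι | v ∈ B x}).Connected)

/-- The treewidth of `G` is at most `w`: there is a tree-decomposition all of whose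
bags have size at most `w + 1`. -/
def TreewidthLE {V : Type} (G : SimpleGraph V) (w : ℕ) : Prop :=
  ∃ (ι : Type) (_ : Fintype ι) (T : SimpleGraph ι) (B : ι → Finset V),
    IsTreeDecomp G T B ∧ ∀ x : ι, (B x).card ≤ w + 1

/-- For integers `N ≥ X > 0`: `Δ(a) = X - a` if `a < X`, and
`Δ(a) = N - ((a - X) % N)` if `a ≥ X`. -/
def delta (N X a : ℕ) : ℕ := if a < X then X - a else N - ((a - X) % N)

/-- A rooted tree structure on the nodes of a tree. -/
theorem exists_parent {ι : Type} (T : SimpleGraph ι) (hT : T.IsTree) (r : ι) :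
    ∃ (par : ι → ι) (d : ι → ℕ), par r = r ∧ (∀ x, x ≠ r → d x = d (par x) + 1) ∧
      ∀ a b, T.Adj a b → a = par b ∨ b = par a := by
  classical
  have key : ∀ x, ∃ y, (x = r → y = r) ∧ (x ≠ r → T.dist x r = T.dist y r + 1 ∧
      ∀ z, T.Adj x z → T.dist x r = T.dist z r + 1 → z = y) := by
    intro x
    by_cases hx : x = r
    · exact ⟨r, fun _ => rfl, fun h => absurd hx h⟩
    · obtain ⟨p, hp, hlen⟩ := hT.connected.exists_path_of_dist x r
      cases p with
      | nil => exact absurd rfl hx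
      | @cons _ y _ h q =>
        refine ⟨y, fun h => absurd h hx, fun _ => ⟨?_, ?_⟩⟩
        · have h1 := SimpleGraph.dist_le q
          have h2 := hT.dist_eq_dist_add_one_of_adj r h
          rw [SimpleGraph.dist_comm (u := r) (v := x), SimpleGraph.dist_comm (u := r) (v := y)] at h2
          simp only [SimpleGraph.Walk.length_cons] at hlen
          omega
        · intro z hz hd
          obtain ⟨q', hq'⟩ := hT.connected.exists_walk_length_eq_dist z r
          have hpath : (SimpleGraph.Walk.cons hz q').IsPath := by
            apply SimpleGraph.Walk.isPath_of_length_eq_dist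
            simp [hq', hd]
          have := (hT.existsUnique_path x r).unique hp hpath
          have h3 := congrArg (fun w => w.snd) this
          simpa using h3.symm
  choose par h1 h2 using key
  refine ⟨par, fun x => T.dist x r, h1 r rfl, fun x hx => (h2 x hx).1, ?_⟩
  intro a b hab
  have h := hT.dist_eq_dist_add_one_of_adj r hab
  rw [SimpleGraph.dist_comm (u := r) (v := a), SimpleGraph.dist_comm (u := r) (v := b)] at h
  rcases h with h | h
  · right
    refine (h2 a ?_).2 b hab h
    rintro rfl
    simp at h
  · left
    refine (h2 b ?_).2 a hab.symm h
    rintro rfl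
    simp at h

/-- Rooted decompositions with bags of size at most `w + 1`. -/
inductive RDec {V : Type} [DecidableEq V] (G : SimpleGraph V) (w : ℕ) :
    Finset V → Finset V → Prop
  | nil (S : Finset V) : RDec G w S ∅
  | union (S A B : Finset V) : RDec G w S A → RDec G w S B → Disjoint A B → RDec G w S (A ∪ B)
  | mono (S S' A : Finset V) : RDec G w S A → S ⊆ S' → Disjoint S' A → RDec G w S' A
  | intro (S A : Finset V) (v : V) : RDec G w (insert v S) A → v ∉ S → v ∉ A → S.card ≤ w →
      (∀ u, G.Adj v u → u ∈ S ∨ u ∈ A) → RDec G w S (insert v A)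

/-- Rooted decompositions with bags of size exactly `w + 1`, adjacent bags differing by
a single exchange. -/
inductive XDec {V : Type} [DecidableEq V] (G : SimpleGraph V) (w : ℕ) :
    Finset V → Finset V → Prop
  | nil (S : Finset V) : S.card = w + 1 → XDec G w S ∅
  | union (S A B : Finset V) : XDec G w S A → XDec G w S B → Disjoint A B → XDec G w S (A ∪ B)
  | swap (S A : Finset V) (u v : V) : XDec G w (insert v (S.erase u)) A → u ∈ S → v ∉ S →
      v ∉ A → u ∉ A → (∀ z, G.Adj v z → z ∈ S ∨ z ∈ A) → XDec G w S (insert v A)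

section
variable {V : Type} [DecidableEq V] {G : SimpleGraph V} {w : ℕ}

theorem XDec.card {S D : Finset V} (h : XDec G w S D) : S.card = w + 1 := by
  induction h with
  | nil S h => exact h
  | union S A B _ _ _ ih _ => exact ih
  | swap S A u v _ hu hv _ _ _ ih =>
    rw [Finset.card_insert_of_notMem (by simp [hv]), Finset.card_erase_of_mem hu] at ih
    have := Finset.card_pos.2 ⟨u, hu⟩
    omega

theorem XDec.disj {S D : Finset V} (h : XDec G w S D) : Disjoint S D := by
  induction h with
  | nil S h => simp
  | union S A B _ _ _ ih1 ih2 => simp [ih1, ih2]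
  | swap S A u v _ hu hv _ huA _ ih =>
    rw [Finset.disjoint_left] at *
    grind

theorem XDec.closed {S D : Finset V} (h : XDec G w S D) :
    ∀ v ∈ D, ∀ u, G.Adj v u → u ∈ S ∨ u ∈ D := by
  induction h with
  | nil S h => simp
  | union S A B _ _ _ ih1 ih2 => grind
  | swap S A u v _ hu hv _ huA _ ih => grind

theorem RDec.disj {S D : Finset V} (h : RDec G w S D) : Disjoint S D := by
  induction h with
  | nil S => simp
  | union S A B _ _ _ ih1 ih2 => simp [ih1, ih2]
  | mono S S' A _ _ h => exact h
  | intro S A v _ hv _ _ _ ih =>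
    rw [Finset.disjoint_left] at *
    grind

theorem RDec.toX {S D : Finset V} (h : RDec G w S D) :
    ∀ S', S ⊆ S' → Disjoint S' D → S'.card = w + 1 → XDec G w S' D := by
  induction h with
  | nil S => exact fun S' _ _ h => XDec.nil S' h
  | union S A B _ _ hAB ih1 ih2 =>
    intro S' hS hd hc
    rw [Finset.disjoint_union_right] at hd
    exact XDec.union _ _ _ (ih1 S' hS hd.1 hc) (ih2 S' hS hd.2 hc) hAB
  | mono S S1 A _ hS h ih => exact fun S' h1 hd hc => ih S' (hS.trans h1) hd hc
  | intro S A v _ hv hvA hcard hcl ih =>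
    intro S' hS hd hc
    rw [Finset.disjoint_left] at hd
    have hvS' : v ∉ S' := fun h => hd h (by simp)
    obtain ⟨u, hu, huS⟩ : ∃ u ∈ S', u ∉ S :=
      Finset.exists_mem_notMem_of_card_lt_card (by omega)
    refine XDec.swap S' A u v (ih _ ?_ ?_ ?_) hu hvS' hvA ?_ ?_
    · grind
    · rw [Finset.disjoint_left]; grind
    · rw [Finset.card_insert_of_notMem (by simp [hvS']), Finset.card_erase_of_mem hu]
      omega
    · grind
    · grind

theorem RDec.root {S D : Finset V} (h : RDec G w S D) :
    ∀ S', S ⊆ S' → Disjoint S' D → S'.card ≤ w + 1 → w + 1 ≤ S'.card + D.card →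
      ∃ S'', S' ⊆ S'' ∧ S'' ⊆ S' ∪ D ∧ XDec G w S'' ((S' ∪ D) \ S'') := by
  induction h with
  | nil S =>
    intro S' _ _ h1 h2
    refine ⟨S', subset_rfl, by simp, ?_⟩
    simp only [Finset.union_empty, sdiff_self]
    exact XDec.nil S' (by simp at h2; omega)
  | union S A B hA hB hAB ih1 ih2 =>
    intro S' hS hd h1 h2
    rw [Finset.disjoint_union_right] at hd
    rw [Finset.card_union_of_disjoint hAB] at h2
    by_cases hc : w + 1 ≤ S'.card + A.card
    · obtain ⟨S'', hs1, hs2, hx⟩ := ih1 S' hS hd.1 h1 hc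
      have hdB : Disjoint S'' B := by
        refine Finset.disjoint_of_subset_left hs2 ?_
        rw [Finset.disjoint_union_left]
        exact ⟨hd.2, hAB⟩
      refine ⟨S'', hs1, hs2.trans (by rw [← Finset.union_assoc]; exact Finset.subset_union_left), ?_⟩
      have := XDec.union _ _ _ hx (hB.toX S'' (hS.trans hs1) hdB hx.card) (by
        have h3 := hd.2
        refine Finset.disjoint_of_subset_left Finset.sdiff_subset ?_
        rw [Finset.disjoint_union_left]
        exact ⟨h3, hAB⟩)
      have he : (S' ∪ (A ∪ B)) \ S'' = (S' ∪ A) \ S'' ∪ B := by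
        rw [← Finset.union_assoc, Finset.union_sdiff_distrib,
          Finset.sdiff_eq_self_of_disjoint hdB.symm]
      rw [he]
      exact this
    · have hc' : (S' ∪ A).card = S'.card + A.card := Finset.card_union_of_disjoint hd.1
      obtain ⟨S'', hs1, hs2, hx⟩ := ih2 (S' ∪ A) (by grind) (by simp [hd.2, hAB]) (by omega)
        (by omega)
      refine ⟨S'', by grind, by grind, ?_⟩
      rwa [Finset.union_assoc] at hx
  | mono S S1 A _ hS h ih => exact fun S' h1 => ih S' (hS.trans h1)
  | intro S A v hr hv hvA hcard hcl ih =>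
    intro S' hS hd h1 h2
    by_cases hc : S'.card = w + 1
    · refine ⟨S', subset_rfl, by grind, ?_⟩
      have := (RDec.intro S A v hr hv hvA hcard hcl).toX S' hS hd hc
      convert this using 1
      rw [Finset.union_sdiff_left]
      exact Finset.sdiff_eq_self_of_disjoint hd.symm
    · have hd2 := hd
      rw [Finset.disjoint_left] at hd2
      have hvS' : v ∉ S' := fun h => hd2 h (by simp)
      have h3 : (insert v S').card = S'.card + 1 := Finset.card_insert_of_notMem hvS'
      have h4 : (insert v A).card = A.card + 1 := Finset.card_insert_of_notMem hvA
      obtain ⟨S'', hs1, hs2, hx⟩ := ih (insert v S') (by grind)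
        (by rw [Finset.disjoint_left]; grind) (by omega) (by omega)
      refine ⟨S'', by grind, by grind, ?_⟩
      convert hx using 1
      grind

theorem RDec.intros (A : Finset V) : ∀ (S D : Finset V), RDec G w (S ∪ A) D →
    Disjoint S A → Disjoint A D → (S ∪ A).card ≤ w + 1 →
    (∀ v ∈ A, ∀ u, G.Adj v u → u ∈ S ∨ u ∈ A ∨ u ∈ D) → RDec G w S (A ∪ D) := by
  induction A using Finset.induction_on with
  | empty => intro S D h _ _ _ _; simpa using h
  | insert v A hv ih =>
    intro S D h h1 h2 h3 h4
    rw [Finset.disjoint_left] at h1 h2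
    have hvS : v ∉ S := fun h => h1 h (by simp)
    rw [Finset.insert_union]
    refine RDec.intro S (A ∪ D) v (ih (insert v S) D ?_ ?_ ?_ ?_ ?_) hvS ?_ ?_ ?_
    · convert h using 1; grind
    · rw [Finset.disjoint_left]; grind
    · rw [Finset.disjoint_left]; grind
    · convert h3 using 2; grind
    · grind
    · grind
    · have : (insert v S).card ≤ (S ∪ insert v A).card := Finset.card_le_card (by grind)
      rw [Finset.card_insert_of_notMem hvS] at this
      omega
    · intro u hu
      have hne := hu.ne
      have := h4 v (by simp) u hu
      grind

theorem RDec.biUnion {α : Type} [DecidableEq α] (S : Finset V) (E : α → Finset V) (s : Finset α) :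
    (∀ c ∈ s, RDec G w S (E c)) → (∀ c ∈ s, ∀ c' ∈ s, c ≠ c' → Disjoint (E c) (E c')) →
    RDec G w S (s.biUnion E) := by
  induction s using Finset.induction_on with
  | empty => intro _ _; simpa using RDec.nil S
  | insert a s ha ih =>
    intro h1 h2
    rw [Finset.biUnion_insert]
    refine RDec.union _ _ _ (h1 a (by simp)) (ih (fun c hc => h1 c (by simp [hc]))
      (fun c hc c' hc' => h2 c (by simp [hc]) c' (by simp [hc']))) ?_
    rw [Finset.disjoint_biUnion_right]
    intro c hc
    exact h2 a (by simp) c (by simp [hc]) (by rintro rfl; exact ha hc)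

theorem exists_XDec [Fintype V] (htw : TreewidthLE G w) (hn : w + 1 ≤ Fintype.card V) :
    ∃ S, XDec G w S (Finset.univ \ S) := by
  classical
  obtain ⟨ι, _, T, B, ⟨hT, hcov, hedge, hconn⟩, hB⟩ := htw
  obtain ⟨r⟩ := hT.connected.nonempty
  obtain ⟨par, d, hpr, hd, hadj⟩ := exists_parent T hT r
  let sub : ι → ι → Prop := fun x y => ∃ k, par^[k] y = x
  have sub_refl : ∀ x, sub x x := fun x => ⟨0, rfl⟩
  have dpar : ∀ x, d (par x) ≤ d x := by
    intro x
    by_cases hx : x = r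
    · subst hx; rw [hpr]
    · have := hd x hx; omega
  have dit : ∀ k x, d (par^[k] x) ≤ d x := by
    intro k
    induction k with
    | zero => intro x; simp
    | succ k ih => intro x; rw [Function.iterate_succ_apply]; exact (ih _).trans (dpar x)
  have sub_par : ∀ x y, sub x (par y) → sub x y := by
    rintro x y ⟨k, hk⟩
    exact ⟨k + 1, by rw [Function.iterate_succ_apply]; exact hk⟩
  have par_sub : ∀ x y, sub x y → y ≠ x → sub x (par y) := by
    rintro x y ⟨k, hk⟩ hne
    cases k with
    | zero => exact absurd hk hne
    | succ k => exact ⟨k, by rw [Function.iterate_succ_apply] at hk; exact hk⟩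
  have cross : ∀ x v y z, v ∈ B y → sub x y → v ∈ B z → ¬ sub x z → v ∈ B x ∧ v ∈ B (par x) := by
    intro x v y z hy hsy hz hsz
    obtain ⟨p⟩ := (hconn v).preconnected ⟨y, hy⟩ ⟨z, hz⟩
    obtain ⟨e, _, he1, he2⟩ := p.exists_boundary_dart {q | sub x q.1} hsy hsz
    have ha : T.Adj e.fst.1 e.snd.1 := e.adj
    have m1 : v ∈ B e.fst.1 := e.fst.2
    have m2 : v ∈ B e.snd.1 := e.snd.2
    simp only [Set.mem_ofPred_eq] at he1 he2
    rcases hadj _ _ ha with h | h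
    · exact absurd (sub_par _ _ (h ▸ he1)) he2
    · by_cases hx : e.fst.1 = x
      · rw [← hx, ← h]; exact ⟨m1, m2⟩
      · exact absurd (h ▸ par_sub _ _ he1 hx) he2
  have sub_child : ∀ x y, sub x y → y = x ∨ ∃ c, c ≠ r ∧ par c = x ∧ sub c y := by
    rintro x y ⟨k, hk⟩
    induction k with
    | zero => exact Or.inl hk
    | succ k ih =>
      rw [Function.iterate_succ_apply'] at hk
      by_cases hr : par^[k] y = r
      · apply ih
        rw [hr] at hk ⊢
        rw [← hk, hpr]
      · exact Or.inr ⟨_, hr, hk, k, rfl⟩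
  have aux : ∀ c c' y k l, c ≠ r → c' ≠ r → par c = par c' → par^[k] y = c → par^[l] y = c' →
      k ≤ l → c = c' := by
    intro c c' y k l hc hc' hp hk hl hkl
    obtain ⟨j, rfl⟩ := Nat.exists_eq_add_of_le hkl
    rw [Nat.add_comm, Function.iterate_add_apply, hk] at hl
    cases j with
    | zero => exact hl
    | succ j =>
      exfalso
      rw [Function.iterate_succ_apply, hp] at hl
      have h1 := dit j (par c')
      rw [hl] at h1
      have := hd c' hc'
      omega
  have uniq : ∀ c c' y, c ≠ r → c' ≠ r → par c = par c' → sub c y → sub c' y → c = c' := by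
    rintro c c' y hc hc' hp ⟨k, hk⟩ ⟨l, hl⟩
    rcases le_total k l with h | h
    · exact aux c c' y k l hc hc' hp hk hl h
    · exact (aux c' c y l k hc' hc hp.symm hl hk h).symm
  have nsub : ∀ c, c ≠ r → ¬ sub c (par c) := by
    rintro c hc ⟨k, hk⟩
    have h1 := dit k (par c)
    rw [hk] at h1
    have := hd c hc
    omega
  let E : ι → Finset V := fun c => Finset.univ.filter
    (fun v => v ∉ B (par c) ∧ ∃ y, sub c y ∧ v ∈ B y)
  let D : ι → Finset V := fun c => Finset.univ.filter
    (fun v => v ∉ B c ∧ ∃ y, sub c y ∧ v ∈ B y)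
  obtain ⟨M, hM⟩ : ∃ M, ∀ x, d x ≤ M := by
    refine ⟨Finset.univ.sup d, fun x => Finset.le_sup (Finset.mem_univ x)⟩
  have main : ∀ n x, M < n + d x → RDec G w (B x) (D x) := by
    intro n
    induction n with
    | zero => intro x hx; have := hM x; omega
    | succ n ih =>
      intro x hx
      have hDE : D x = (Finset.univ.filter (fun c => c ≠ r ∧ par c = x)).biUnion E := by
        ext v
        simp only [D, E, Finset.mem_filter, Finset.mem_univ, true_and, Finset.mem_biUnion]
        constructor
        · rintro ⟨hv, y, hy, hvy⟩
          rcases sub_child x y hy with rfl | ⟨c, hc, hpc, hcy⟩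
          · exact absurd hvy hv
          · exact ⟨c, ⟨hc, hpc⟩, hpc ▸ hv, y, hcy, hvy⟩
        · rintro ⟨c, ⟨hc, rfl⟩, hv, y, ⟨k, hk⟩, hvy⟩
          exact ⟨hv, y, ⟨k + 1, by rw [Function.iterate_succ_apply', hk]⟩, hvy⟩
      rw [hDE]
      apply RDec.biUnion
      · intro c hc
        simp only [Finset.mem_filter, Finset.mem_univ, true_and] at hc
        obtain ⟨hc, rfl⟩ := hc
        have hdc := hd c hc
        have hrec := ih c (by omega)
        have hE : E c = (B c \ B (par c)) ∪ D c := by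
          ext v
          simp only [D, E, Finset.mem_filter, Finset.mem_univ, true_and, Finset.mem_union,
            Finset.mem_sdiff]
          constructor
          · rintro ⟨h1, h2⟩
            by_cases h3 : v ∈ B c
            · exact Or.inl ⟨h3, h1⟩
            · exact Or.inr ⟨h3, h2⟩
          · rintro (⟨h1, h2⟩ | ⟨h1, y, h2, h3⟩)
            · exact ⟨h2, c, sub_refl c, h1⟩
            · refine ⟨fun h4 => h1 ?_, y, h2, h3⟩
              exact (cross c v y (par c) h3 h2 h4 (nsub c hc)).1
        have hdisj : Disjoint (B (par c)) (E c) := by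
          rw [Finset.disjoint_left]
          intro v h1 h2
          simp only [E, Finset.mem_filter] at h2
          exact h2.2.1 h1
        refine RDec.mono (B c ∩ B (par c)) _ _ ?_ Finset.inter_subset_right hdisj
        have hun : B c ∩ B (par c) ∪ B c \ B (par c) = B c := by grind
        have hcl : ∀ v ∈ E c, ∀ u, G.Adj v u → u ∈ B c ∩ B (par c) ∨ u ∈ E c := by
          intro v hv u huv
          simp only [E, Finset.mem_filter, Finset.mem_univ, true_and, Finset.mem_inter] at hv ⊢
          obtain ⟨hv1, y, hy, hvy⟩ := hv
          obtain ⟨z, hz1, hz2⟩ := hedge v u huv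
          have hz : sub c z := by
            by_contra hz
            exact hv1 (cross c v y z hvy hy hz1 hz).2
          by_cases hu : u ∈ B (par c)
          · exact Or.inl ⟨(cross c u z (par c) hz2 hz hu (nsub c hc)).1, hu⟩
          · exact Or.inr ⟨hu, z, hz, hz2⟩
        rw [hE]
        apply RDec.intros 
        · rw [hun]; exact hrec
        · rw [Finset.disjoint_left]; grind
        · rw [Finset.disjoint_left]
          intro v h1 h2
          simp only [D, Finset.mem_filter] at h2
          exact h2.2.1 (Finset.mem_sdiff.1 h1).1
        · rw [hun]; exact hB c
        · intro v hv u huv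
          have := hcl v (by rw [hE]; exact Finset.mem_union_left _ hv) u huv
          rw [hE, Finset.mem_union] at this
          exact this
      · intro c hc c' hc' hne
        simp only [Finset.mem_filter, Finset.mem_univ, true_and] at hc hc'
        rw [Finset.disjoint_left]
        intro v h1 h2
        simp only [E, Finset.mem_filter, Finset.mem_univ, true_and] at h1 h2
        obtain ⟨h1, y, hy, hvy⟩ := h1
        obtain ⟨h2, z, hz, hvz⟩ := h2
        have hzc : ¬ sub c z := fun h => hne
          (uniq c c' z hc.1 hc'.1 (hc.2.trans hc'.2.symm) h hz)
        exact h1 (cross c v y z hvy hy hvz hzc).2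
  have hroot := main (M + 1) r (by omega)
  have subr : ∀ n y, d y ≤ n → sub r y := by
    intro n
    induction n with
    | zero =>
      intro y hy
      by_cases h : y = r
      · exact h ▸ sub_refl r
      · have := hd y h; omega
    | succ n ih =>
      intro y hy
      by_cases h : y = r
      · exact h ▸ sub_refl r
      · have := hd y h
        exact sub_par _ _ (ih _ (by omega))
  have huniv : B r ∪ D r = Finset.univ := by
    ext v
    simp only [D, Finset.mem_union, Finset.mem_filter, Finset.mem_univ, true_and, iff_true]
    by_cases h : v ∈ B r
    · exact Or.inl h
    · obtain ⟨y, hy⟩ := hcov v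
      exact Or.inr ⟨h, y, subr _ y le_rfl, hy⟩
  obtain ⟨S, _, _, hS⟩ := hroot.root (B r) subset_rfl hroot.disj (hB r) (by
    rw [← Finset.card_union_of_disjoint hroot.disj, huniv, Finset.card_univ]; exact hn)
  rw [huniv] at hS
  exact ⟨S, hS⟩

end

theorem delta_high {N X a : ℕ} (h1 : N + X ≤ a) (h2 : a < 2 * N + X) :
    delta N X a = 2 * N + X - a := by
  have h3 : (a - X) % N = a - X - N := by
    rw [Nat.mod_eq_sub_mod (by omega), Nat.mod_eq_of_lt (by omega)]
  unfold delta
  rw [if_neg (by omega), h3]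
  omega

theorem delta_mid {N X a : ℕ} (h1 : X ≤ a) (h2 : a < N + X) :
    delta N X a = N + X - a := by
  have h3 : (a - X) % N = a - X := Nat.mod_eq_of_lt (by omega)
  unfold delta
  rw [if_neg (by omega), h3]
  omega

theorem greedy {α : Type} [DecidableEq α] (f : α → ℕ) (k lo : ℕ) (hk : 1 ≤ k) (s : Finset α) :
    (∀ c ∈ s, f c ≤ k) → lo ≤ ∑ c ∈ s, f c →
      ∃ P ⊆ s, lo ≤ ∑ c ∈ P, f c ∧ ∑ c ∈ P, f c < lo + k := by
  induction s using Finset.induction_on with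
  | empty =>
    intro _ h
    exact ⟨∅, subset_rfl, h, by simp; omega⟩
  | insert a s ha ih =>
    intro h1 h2
    by_cases h : lo ≤ ∑ c ∈ s, f c
    · obtain ⟨P, hP, h3⟩ := ih (fun c hc => h1 c (by simp [hc])) h
      exact ⟨P, hP.trans (Finset.subset_insert _ _), h3⟩
    · refine ⟨insert a s, subset_rfl, h2, ?_⟩
      rw [Finset.sum_insert ha]
      have := h1 a (by simp)
      omega

/-- The numerical selection property of a family of sizes. -/
def Sel {α : Type} (f : α → ℕ) (N X : ℕ) (s : Finset α) : Prop :=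
  ∃ P Q, P ⊆ s ∧ Q ⊆ s ∧ Disjoint P Q ∧ ∑ c ∈ P, f c ≤ 2 * N + X ∧
    ∑ c ∈ Q, f c ≤ 2 * N + delta N X (∑ c ∈ P, f c) ∧
    2 * N + X ≤ ∑ c ∈ P, f c + ∑ c ∈ Q, f c

theorem sel_high {α : Type} [DecidableEq α] (f : α → ℕ) (N X : ℕ) (hN : 1 ≤ N) (s P : Finset α)
    (hP : P ⊆ s) (h1 : N + X ≤ ∑ c ∈ P, f c) (h2 : ∑ c ∈ P, f c < 2 * N + X)
    (hs : 2 * N + X ≤ ∑ c ∈ s, f c) (hf : ∀ c ∈ s \ P, f c ≤ 2 * N) : Sel f N X s := by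
  have hsum := Finset.sum_sdiff (f := f) hP
  obtain ⟨Q, hQ, h3, h4⟩ := greedy f (2 * N) (2 * N + X - ∑ c ∈ P, f c) (by omega) (s \ P) hf
    (by omega)
  refine ⟨P, Q, hP, hQ.trans Finset.sdiff_subset, ?_, h2.le, ?_, by omega⟩
  · exact Finset.disjoint_of_subset_right hQ Finset.disjoint_sdiff
  · rw [delta_high h1 h2]; omega

theorem selection {α : Type} [DecidableEq α] (f : α → ℕ) (N X : ℕ) (hX : 0 < X) (hN : X ≤ N)
    (s : Finset α) (hf : ∀ c ∈ s, f c ≤ 2 * N + X) (hs : 2 * N + X ≤ ∑ c ∈ s, f c) :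
    Sel f N X s ∨ ∃ c₁ ∈ s, ∃ c₂ ∈ s, c₁ ≠ c₂ ∧ f c₁ < 2 * N + X ∧ f c₂ < 2 * N + X ∧
      4 * N + X < f c₁ + f c₂ := by
  by_cases h1 : ∃ c ∈ s, f c = 2 * N + X
  · obtain ⟨c, hc, hfc⟩ := h1
    left
    exact ⟨{c}, ∅, by simpa using hc, by simp, by simp, by simp [hfc], by simp, by simp [hfc]⟩
  have hlt : ∀ c ∈ s, f c < 2 * N + X := by
    intro c hc
    have := hf c hc
    have : f c ≠ 2 * N + X := fun h => h1 ⟨c, hc, h⟩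
    omega
  by_cases h2 : ∃ c ∈ s, N + X ≤ f c
  · obtain ⟨c, hc, hfc⟩ := h2
    have hc2 := hlt c hc
    by_cases h3 : ∃ c' ∈ s, c' ≠ c ∧ 4 * N + X < f c + f c'
    · obtain ⟨c', hc', hne, h⟩ := h3
      exact Or.inr ⟨c, hc, c', hc', hne.symm, hc2, hlt c' hc', h⟩
    left
    by_cases h4 : ∃ c' ∈ s, c' ≠ c ∧ 2 * N + X ≤ f c + f c'
    · obtain ⟨c', hc', hne, h⟩ := h4
      have h5 : ¬ 4 * N + X < f c + f c' := fun h => h3 ⟨c', hc', hne, h⟩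
      refine ⟨{c}, {c'}, by simpa using hc, by simpa using hc', by simpa using hne.symm,
        by simpa using hc2.le, ?_, by simpa using h⟩
      simp only [Finset.sum_singleton]
      rw [delta_high hfc hc2]
      omega
    · refine sel_high f N X (by omega) s {c} (by simpa using hc) (by simpa using hfc)
        (by simpa using hc2) hs ?_
      intro c' hc'
      simp only [Finset.mem_sdiff, Finset.mem_singleton] at hc'
      have : ¬ 2 * N + X ≤ f c + f c' := fun h => h4 ⟨c', hc'.1, hc'.2, h⟩
      omega
  have hlt2 : ∀ c ∈ s, f c < N + X := by
    intro c hc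
    by_contra h
    exact h2 ⟨c, hc, by omega⟩
  left
  by_cases h3 : ∃ c ∈ s, N < f c
  · obtain ⟨c, hc, hfc⟩ := h3
    have hc2 := hlt2 c hc
    by_cases h4 : ∃ c' ∈ s, c' ≠ c ∧ N < f c'
    · obtain ⟨c', hc', hne, h⟩ := h4
      have hc2' := hlt2 c' hc'
      by_cases h5 : 2 * N + X ≤ f c + f c'
      · refine ⟨{c}, {c'}, by simpa using hc, by simpa using hc', by simpa using hne.symm,
          by simp; omega, ?_, by simpa using h5⟩
        simp only [Finset.sum_singleton]
        rw [delta_mid (by omega) hc2]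
        omega
      · have hpair : ∑ x ∈ {c, c'}, f x = f c + f c' := Finset.sum_pair hne.symm
        refine sel_high f N X (by omega) s {c, c'} ?_ (by omega) (by omega) hs ?_
        · intro x hx
          simp only [Finset.mem_insert, Finset.mem_singleton] at hx
          rcases hx with rfl | rfl <;> assumption
        · intro x hx
          have := hlt2 x (Finset.mem_sdiff.1 hx).1
          omega
    · have hsum := Finset.add_sum_erase s f hc
      obtain ⟨P, hP, h5, h6⟩ := greedy f N (N + X - f c) (by omega) (s.erase c) (by
        intro x hx
        rw [Finset.mem_erase] at hx
        by_contra h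
        exact h4 ⟨x, hx.2, hx.1, by omega⟩) (by omega)
      have hcP : c ∉ P := fun h => by simpa using hP h
      have hins : ∑ x ∈ insert c P, f x = f c + ∑ x ∈ P, f x := Finset.sum_insert hcP
      refine sel_high f N X (by omega) s (insert c P) ?_ (by omega) (by omega) hs ?_
      · exact Finset.insert_subset hc (hP.trans (Finset.erase_subset _ _))
      · intro x hx
        have := hlt2 x (Finset.mem_sdiff.1 hx).1
        omega
  · have hle : ∀ c ∈ s, f c ≤ N := by
      intro c hc
      by_contra h
      exact h3 ⟨c, hc, by omega⟩
    obtain ⟨P, hP, h5, h6⟩ := greedy f N X (by omega) s hle (by omega)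
    have hsum := Finset.sum_sdiff (f := f) hP
    obtain ⟨Q, hQ, h7, h8⟩ := greedy f N (2 * N + X - ∑ c ∈ P, f c) (by omega) (s \ P)
      (fun c hc => hle c (Finset.mem_sdiff.1 hc).1) (by omega)
    refine ⟨P, Q, hP, hQ.trans Finset.sdiff_subset, ?_, by omega, ?_, by omega⟩
    · exact Finset.disjoint_of_subset_right hQ Finset.disjoint_sdiff
    · rw [delta_mid h5 (by omega)]; omega

section
variable {V : Type} [DecidableEq V] {G : SimpleGraph V} {w : ℕ}

/-- `A` is disjoint from `S` and all neighbours of `A` lie in `S ∪ A`. -/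
def Cl (G : SimpleGraph V) (S A : Finset V) : Prop :=
  Disjoint S A ∧ ∀ v ∈ A, ∀ u, G.Adj v u → u ∈ S ∨ u ∈ A

theorem Cl.biUnion {S : Finset V} (P : Finset (Finset V)) (h : ∀ C ∈ P, Cl G S C) :
    Cl G S (P.biUnion id) := by
  refine ⟨?_, ?_⟩
  · rw [Finset.disjoint_biUnion_right]
    exact fun C hC => (h C hC).1
  · intro v hv u hu
    rw [Finset.mem_biUnion] at hv
    obtain ⟨C, hC, hvC⟩ := hv
    rcases (h C hC).2 v hvC u hu with h | h
    · exact Or.inl h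
    · exact Or.inr (Finset.mem_biUnion.2 ⟨C, hC, h⟩)

theorem Cl.sdiff {S A B : Finset V} (hA : Cl G S A) (hB : Cl G S B) : Cl G S (A \ B) := by
  refine ⟨Finset.disjoint_of_subset_right Finset.sdiff_subset hA.1, ?_⟩
  intro v hv u hu
  rw [Finset.mem_sdiff] at hv
  rcases hA.2 v hv.1 u hu with h | h
  · exact Or.inl h
  · by_cases huB : u ∈ B
    · rcases hB.2 u huB v hu.symm with h' | h'
      · exact absurd hv.1 (Finset.disjoint_left.1 hA.1 h')
      · exact absurd h' hv.2
    · exact Or.inr (Finset.mem_sdiff.2 ⟨h, huB⟩)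

theorem Cl.compl [Fintype V] (S : Finset V) : Cl G S (Finset.univ \ S) := by
  refine ⟨Finset.disjoint_sdiff, ?_⟩
  intro v _ u _
  by_cases h : u ∈ S <;> simp [h]

/-- The desired conclusion, in condensed form. -/
def Good (G : SimpleGraph V) (w N X : ℕ) : Prop :=
  ∃ S A B, S.card = w + 1 ∧ Cl G S A ∧ Cl G S B ∧ Disjoint A B ∧ A.card ≤ 2 * N + X ∧
    B.card ≤ 2 * N + delta N X A.card ∧ 2 * N + X ≤ A.card + B.card

theorem XDec.children {S D : Finset V} (h : XDec G w S D) :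
    ∃ F : Finset (Finset V), F.biUnion id = D ∧
      (∀ C ∈ F, ∀ C' ∈ F, C ≠ C' → Disjoint C C') ∧
      ∀ C ∈ F, Cl G S C ∧ ∃ S' D', XDec G w S' D' ∧ D'.card + 1 = C.card := by
  induction h with
  | nil S h => exact ⟨∅, by simp, by simp, by simp⟩
  | union S A B _ _ hAB ih1 ih2 =>
    obtain ⟨F1, rfl, h1, h1'⟩ := ih1
    obtain ⟨F2, rfl, h2, h2'⟩ := ih2
    have hc : ∀ C ∈ F1, ∀ C' ∈ F2, Disjoint C C' := by
      intro C hC C' hC'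
      rw [Finset.disjoint_biUnion_left] at hAB
      have := hAB C hC
      rw [Finset.disjoint_biUnion_right] at this
      exact this C' hC'
    refine ⟨F1 ∪ F2, by rw [Finset.union_biUnion], ?_, ?_⟩
    · intro C hC C' hC' hne
      rcases Finset.mem_union.1 hC with hC | hC <;> rcases Finset.mem_union.1 hC' with hC' | hC'
      · exact h1 C hC C' hC' hne
      · exact hc C hC C' hC'
      · exact (hc C' hC' C hC).symm
      · exact h2 C hC C' hC' hne
    · intro C hC
      rcases Finset.mem_union.1 hC with hC | hC
      · exact h1' C hC
      · exact h2' C hC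
  | swap S A u v hx hu hv hvA huA hcl _ =>
    have hx' := XDec.swap S A u v hx hu hv hvA huA hcl
    refine ⟨{insert v A}, by simp, by simp, ?_⟩
    intro C hC
    rw [Finset.mem_singleton] at hC
    subst hC
    exact ⟨⟨hx'.disj, hx'.closed⟩, _, A, hx, (Finset.card_insert_of_notMem hvA).symm⟩

theorem card_fam (F : Finset (Finset V)) (hF : ∀ C ∈ F, ∀ C' ∈ F, C ≠ C' → Disjoint C C') :
    (F.biUnion id).card = ∑ C ∈ F, C.card := by
  rw [Finset.card_biUnion]
  · rfl
  · exact hF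

theorem phase_two [Fintype V] (N X m : ℕ) (hX : 0 < X) (hN : X ≤ N)
    (hm : Fintype.card V = m + (w + 1)) (hm1 : 4 * N + X < m) (hm2 : m ≤ 6 * N + X) :
    ∀ n (S D : Finset V), XDec G w S D → D.card = n → m ≤ D.card + (2 * N + X) →
      D.card < 2 * N + X → Good G w N X := by
  intro n
  induction n using Nat.strong_induction_on with
  | _ n ih =>
  intro S D hx hn h1 h2
  have hS := hx.card
  have hClD : Cl G S D := ⟨hx.disj, hx.closed⟩
  have hD : D ⊆ Finset.univ \ S := by
    intro v hv
    simp only [Finset.mem_sdiff, Finset.mem_univ, true_and]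
    exact Finset.disjoint_right.1 hx.disj hv
  obtain ⟨O, hO⟩ : ∃ O, O = (Finset.univ \ S) \ D := ⟨_, rfl⟩
  have hClO : Cl G S O := hO ▸ (Cl.compl S).sdiff hClD
  have hOD : Disjoint O D := by rw [hO]; exact Finset.sdiff_disjoint
  have hOc : O.card + D.card = m := by
    have h3 := Finset.card_sdiff_add_card_eq_card hD
    have h4 := Finset.card_sdiff_add_card_eq_card (Finset.subset_univ S)
    rw [Finset.card_univ] at h4
    rw [← hO] at h3
    omega
  by_cases hO1 : O.card = 2 * N + X
  · refine ⟨S, O, ∅, hS, hClO, ⟨by simp, by simp⟩, by simp, hO1.le, by simp, by simp [hO1]⟩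
  have hdel : delta N X O.card = 2 * N + X - O.card := delta_high (by omega) (by omega)
  -- a sufficient criterion
  have fin : ∀ B, B ⊆ D → Cl G S B → 2 * N + X ≤ O.card + B.card →
      O.card + B.card ≤ 4 * N + X → Good G w N X := by
    intro B hB hClB h3 h4
    exact ⟨S, O, B, hS, hClO, hClB, Finset.disjoint_of_subset_right hB hOD, by omega,
      by omega, h3⟩
  obtain ⟨F, hFD, hdis, hF⟩ := hx.children
  have hsub : ∀ C ∈ F, C ⊆ D := by
    intro C hC
    rw [← hFD]
    exact Finset.subset_biUnion_of_mem id hC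
  by_cases hbig : ∃ C ∈ F, 4 * N + X < O.card + C.card
  · obtain ⟨C, hC, hCb⟩ := hbig
    have hcard := Finset.card_sdiff_add_card_eq_card (hsub C hC)
    by_cases hr : 2 * N + X ≤ O.card + (D \ C).card
    · exact fin (D \ C) Finset.sdiff_subset (hClD.sdiff (hF C hC).1) hr (by omega)
    · obtain ⟨S', D', hx', hc'⟩ := (hF C hC).2
      exact ih D'.card (by omega) S' D' hx' rfl (by omega) (by omega)
  by_cases hmid : ∃ C ∈ F, 2 * N + X ≤ O.card + C.card
  · obtain ⟨C, hC, hCb⟩ := hmid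
    refine fin C (hsub C hC) (hF C hC).1 hCb ?_
    by_contra h
    exact hbig ⟨C, hC, by omega⟩
  · have hcf := card_fam F hdis
    rw [hFD] at hcf
    obtain ⟨P, hP, h3, h4⟩ := greedy Finset.card (2 * N) (2 * N + X - O.card) (by omega) F (by
      intro C hC
      by_contra h
      exact hmid ⟨C, hC, by omega⟩) (by omega)
    have hPc := card_fam P (fun C hC C' hC' => hdis C (hP hC) C' (hP hC'))
    refine fin (P.biUnion id) ?_ (Cl.biUnion P (fun C hC => (hF C (hP hC)).1)) (by omega) (by omega)
    rw [← hFD]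
    exact Finset.biUnion_subset_biUnion_of_subset_left _ hP

theorem phase_one [Fintype V] (N X m : ℕ) (hX : 0 < X) (hN : X ≤ N)
    (hm : Fintype.card V = m + (w + 1)) (hm2 : m ≤ 6 * N + X) :
    ∀ n (S D : Finset V), XDec G w S D → D.card = n → 2 * N + X ≤ D.card → Good G w N X := by
  intro n
  induction n using Nat.strong_induction_on with
  | _ n ih =>
  intro S D hx hn h1
  have hS := hx.card
  obtain ⟨F, hFD, hdis, hF⟩ := hx.children
  have hsub : ∀ C ∈ F, C ⊆ D := by
    intro C hC
    rw [← hFD]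
    exact Finset.subset_biUnion_of_mem id hC
  have hcf := card_fam F hdis
  rw [hFD] at hcf
  by_cases hbig : ∃ C ∈ F, 2 * N + X < C.card
  · obtain ⟨C, hC, hCb⟩ := hbig
    obtain ⟨S', D', hx', hc'⟩ := (hF C hC).2
    have := Finset.card_le_card (hsub C hC)
    exact ih D'.card (by omega) S' D' hx' rfl (by omega)
  have hsmall : ∀ C ∈ F, C.card ≤ 2 * N + X := by
    intro C hC
    by_contra h
    exact hbig ⟨C, hC, by omega⟩
  rcases selection Finset.card N X hX hN F hsmall (by omega) with h | h
  · obtain ⟨P, Q, hP, hQ, hPQ, h2, h3, h4⟩ := h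
    have hPc := card_fam P (fun C hC C' hC' => hdis C (hP hC) C' (hP hC'))
    have hQc := card_fam Q (fun C hC C' hC' => hdis C (hQ hC) C' (hQ hC'))
    refine ⟨S, P.biUnion id, Q.biUnion id, hS, Cl.biUnion P (fun C hC => (hF C (hP hC)).1),
      Cl.biUnion Q (fun C hC => (hF C (hQ hC)).1), ?_, by omega, by rw [hPc]; omega, by omega⟩
    rw [Finset.disjoint_biUnion_left]
    intro C hC
    rw [Finset.disjoint_biUnion_right]
    intro C' hC'
    refine hdis C (hP hC) C' (hQ hC') ?_
    rintro rfl
    exact Finset.disjoint_left.1 hPQ hC hC'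
  · obtain ⟨C₁, hC₁, C₂, hC₂, hne, h2, h3, h4⟩ := h
    have hcc : ∀ A, Cl G S A → A ⊆ Finset.univ \ S := by
      intro A hA v hv
      simp only [Finset.mem_sdiff, Finset.mem_univ, true_and]
      exact Finset.disjoint_right.1 hA.1 hv
    have hd12 := hdis C₁ hC₁ C₂ hC₂ hne
    have hU : (Finset.univ \ S).card = m := by
      have h5 := Finset.card_sdiff_add_card_eq_card (Finset.subset_univ S)
      rw [Finset.card_univ] at h5
      omega
    have hk1 := Finset.card_sdiff_add_card_eq_card (hcc C₁ (hF C₁ hC₁).1)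
    have hk2 := Finset.card_sdiff_add_card_eq_card (s := C₂) (t := (Finset.univ \ S) \ C₁) (by
      rw [Finset.subset_sdiff]
      exact ⟨hcc C₂ (hF C₂ hC₂).1, hd12.symm⟩)
    by_cases h6 : 2 * N + X + C₂.card ≤ m
    · refine ⟨S, C₁, ((Finset.univ \ S) \ C₁) \ C₂, hS, (hF C₁ hC₁).1,
        ((Cl.compl S).sdiff (hF C₁ hC₁).1).sdiff (hF C₂ hC₂).1, ?_, by omega, ?_, by omega⟩
      · exact Finset.disjoint_of_subset_right Finset.sdiff_subset Finset.disjoint_sdiff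
      · rw [delta_high (by omega) h2]; omega
    · obtain ⟨S', D', hx', hc'⟩ := (hF C₂ hC₂).2
      exact phase_two N X m hX hN hm (by omega) hm2 D'.card S' D' hx' rfl (by omega) (by omega)

end

/-- For `w ≥ 1`, `X > 0`, `N ≥ max(X, w + 1)` and a graph `G` with treewidth at most
`w` and `2N + X + w + 2 ≤ |G| ≤ 5N + X + 2w + 2`, there is a set `S` of exactly
`w + 1` vertices and a partition of `G` minus `S` into parts `G₁, G₂, G₃` with
`|G₁| ≤ 2N + X`, `|G₂| ≤ 2N + Δ(|G₁|)`, `|G₃| ≤ 2N + Δ(|G₁| + |G₂|) + w + 1` and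
`|G₁| + |G₂| ≥ 2N + X`. -/
theorem stmt_10 {V : Type} [Fintype V] [DecidableEq V]
    (G : SimpleGraph V) (w : ℕ) (hw : 1 ≤ w) (htw : TreewidthLE G w)
    (N X : ℕ) (hX : 0 < X) (hN : max X (w + 1) ≤ N)
    (hlow : 2 * N + X + w + 2 ≤ Fintype.card V)
    (hhigh : Fintype.card V ≤ 5 * N + X + 2 * w + 2) :
    ∃ (S G1 G2 G3 : Finset V), S.card = w + 1 ∧
      Disjoint G1 G2 ∧ Disjoint G1 G3 ∧ Disjoint G2 G3 ∧
      G1 ∪ G2 ∪ G3 = Finset.univ \ S ∧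
      (∀ u v : V, G.Adj u v →
        ¬(u ∈ G1 ∧ v ∈ G2) ∧ ¬(u ∈ G1 ∧ v ∈ G3) ∧ ¬(u ∈ G2 ∧ v ∈ G3)) ∧
      G1.card ≤ 2 * N + X ∧
      G2.card ≤ 2 * N + delta N X G1.card ∧
      G3.card ≤ 2 * N + delta N X (G1.card + G2.card) + w + 1 ∧
      2 * N + X ≤ G1.card + G2.card := by
  have hXN : X ≤ N := (le_max_left _ _).trans hN
  have hwN : w + 1 ≤ N := (le_max_right _ _).trans hN
  obtain ⟨S₀, hS₀⟩ := exists_XDec htw (by omega)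
  obtain ⟨m, hm⟩ : ∃ m, Fintype.card V = m + (w + 1) := ⟨Fintype.card V - (w + 1), by omega⟩
  have hcS : (Finset.univ \ S₀).card = m := by
    have h5 := Finset.card_sdiff_add_card_eq_card (Finset.subset_univ S₀)
    rw [Finset.card_univ, hS₀.card] at h5
    omega
  obtain ⟨S, A, B, hS, hA, hB, hAB, h1, h2, h3⟩ :=
    phase_one N X m hX hXN hm (by omega) m S₀ _ hS₀ hcS (by omega)
  have hcl := ((Cl.compl S).sdiff hA).sdiff hB
  obtain ⟨R, hR⟩ : ∃ R, R = ((Finset.univ \ S) \ A) \ B := ⟨_, rfl⟩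
  rw [← hR] at hcl
  have hAS := Finset.disjoint_left.1 hA.1
  have hBS := Finset.disjoint_left.1 hB.1
  have hAR : Disjoint A R := by
    rw [hR]
    exact Finset.disjoint_of_subset_right Finset.sdiff_subset Finset.disjoint_sdiff
  have hBR : Disjoint B R := by
    rw [hR]
    exact Finset.disjoint_sdiff
  have hun : A ∪ B ∪ R = Finset.univ \ S := by
    ext v
    simp only [hR, Finset.mem_union, Finset.mem_sdiff, Finset.mem_univ, true_and]
    have := @hAS v
    have := @hBS v
    tauto
  refine ⟨S, A, B, R, hS, hAB, hAR, hBR, hun, ?_, h1, h2, ?_, h3⟩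
  · intro u v huv
    refine ⟨?_, ?_, ?_⟩
    · rintro ⟨hu, hv⟩
      rcases hA.2 u hu v huv with h | h
      · exact hBS h hv
      · exact Finset.disjoint_left.1 hAB h hv
    · rintro ⟨hu, hv⟩
      rcases hA.2 u hu v huv with h | h
      · exact Finset.disjoint_left.1 hcl.1 h hv
      · exact Finset.disjoint_left.1 hAR h hv
    · rintro ⟨hu, hv⟩
      rcases hB.2 u hu v huv with h | h
      · exact Finset.disjoint_left.1 hcl.1 h hv
      · exact Finset.disjoint_left.1 hBR h hv
  · have hc : A.card + B.card + R.card = m := by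
      rw [← Finset.card_union_of_disjoint hAB, ← Finset.card_union_of_disjoint
        (Finset.disjoint_union_left.2 ⟨hAR, hBR⟩), hun]
      have h5 := Finset.card_sdiff_add_card_eq_card (Finset.subset_univ S)
      rw [Finset.card_univ] at h5
      omega
    -- either `a + b + Δ(a + b) ≥ 3 N + X`
    have hdel : 3 * N + X ≤ A.card + B.card + delta N X (A.card + B.card) := by
      unfold delta
      rw [if_neg (by omega)]
      have hlt := Nat.mod_lt (A.card + B.card - X) (show 0 < N by omega)
      by_cases h : 3 * N + X ≤ A.card + B.card
      · omega
      · have h7 : (A.card + B.card - X) % N = A.card + B.card - X - N - N := by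
          rw [Nat.mod_eq_sub_mod (by omega), Nat.mod_eq_sub_mod (by omega),
            Nat.mod_eq_of_lt (by omega)]
        omega
    omega
end

section
/- Let w ≥ 1 and X, N be integers with X > 0 and N ≥ max(X, w + 1), and let G be a graph with treewidth at most w and 5N + X + 2w + 3 ≤ |G| ≤ 8N + X + 3w + 3. Define I_6 = c if |G| = 8N + X + 2w + 2 + c for some integer 1 ≤ c ≤ w + 1, and set I_i = 0 in all other cases (in particular I_i = 0 for 2 ≤ i ≤ 5). Then there exists a set S_1 of exactly w + 1 vertices of G and a partition of G minus S_1 into parts G_1, G_2, G_4, Ḡ, and a set S_2 of exactly w + 1 vertices of Ḡ and a partition of Ḡ minus S_2 into parts G_3, G_5, G_6, such that |G_1| ≤ 2N + X, |G_1| + |G_2| ≥ (3/2)·N + X, and |G_i| ≤ 2N + Δ(|G_1| + ⋯ + |G_{i−1}|) + I_i for every i with 2 ≤ i ≤ 6. -/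
/-- Purely set-theoretic rooted tree structures: `RT M S D F` has root bag `S`, set `D` of vertices
strictly below the root, and set of bags `F`. -/
inductive RT {V : Type} [DecidableEq V] (M : ℕ) :
    Finset V → Finset V → Set (Finset V) → Prop
  | leaf (S : Finset V) : S.card ≤ M → RT M S ∅ {S}
  | forget (S D : Finset V) (F : Set (Finset V)) (a : V) : RT M S D F → a ∉ S → a ∉ D →
      (insert a S).card ≤ M → RT M (insert a S) D (insert (insert a S) F)
  | intro (S D : Finset V) (F : Set (Finset V)) (v : V) : RT M (insert v S) D F → v ∉ S →
      RT M S (insert v D) (insert S F)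
  | join (S D1 D2 : Finset V) (F1 F2 : Set (Finset V)) : RT M S D1 F1 → RT M S D2 F2 →
      Disjoint D1 D2 → RT M S (D1 ∪ D2) (F1 ∪ F2)

section RTsec
variable {V : Type} [DecidableEq V] {M : ℕ}

theorem RT.basic {S D : Finset V} {F : Set (Finset V)} (h : RT M S D F) :
    S.card ≤ M ∧ Disjoint S D ∧ (∀ C ∈ F, C ⊆ S ∪ D) ∧ (∀ C ∈ F, C.card ≤ M) ∧ S ∈ F := by
  induction h with
  | leaf S hS => simp [hS]
  | forget S D F a h ha haD hc ih =>
    obtain ⟨h1, h2, h3, h4, h5⟩ := ih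
    refine ⟨hc, ?_, ?_, ?_, by simp⟩
    · rw [Finset.disjoint_insert_left]; exact ⟨haD, h2⟩
    · rintro C (rfl | hC)
      · exact Finset.subset_union_left
      · intro x hx
        have := h3 C hC hx
        simp only [Finset.mem_union, Finset.mem_insert] at this ⊢
        tauto
    · rintro C (rfl | hC)
      · exact hc
      · exact h4 C hC
  | intro S D F v h hv ih =>
    obtain ⟨h1, h2, h3, h4, h5⟩ := ih
    have hS : S.card ≤ M := (Finset.card_le_card (Finset.subset_insert v S)).trans h1
    rw [Finset.disjoint_insert_left] at h2
    refine ⟨hS, ?_, ?_, ?_, by simp⟩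
    · rw [Finset.disjoint_insert_right]; exact ⟨hv, h2.2⟩
    · rintro C (rfl | hC)
      · exact Finset.subset_union_left
      · intro x hx
        have := h3 C hC hx
        simp only [Finset.mem_union, Finset.mem_insert] at this ⊢
        tauto
    · rintro C (rfl | hC)
      · exact hS
      · exact h4 C hC
  | join S D1 D2 F1 F2 h1 h2 hd ih1 ih2 =>
    obtain ⟨a1, a2, a3, a4, a5⟩ := ih1
    obtain ⟨b1, b2, b3, b4, b5⟩ := ih2
    refine ⟨a1, ?_, ?_, ?_, Or.inl a5⟩
    · rw [Finset.disjoint_union_right]; exact ⟨a2, b2⟩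
    · rintro C (hC | hC) x hx
      · have := a3 C hC hx
        simp only [Finset.mem_union] at this ⊢
        tauto
      · have := b3 C hC hx
        simp only [Finset.mem_union] at this ⊢
        tauto
    · rintro C (hC | hC)
      · exact a4 C hC
      · exact b4 C hC

theorem RT.graft {S D : Finset V} {F : Set (Finset V)} (h : RT M S D F) :
    ∀ (C D' : Finset V) (F' : Set (Finset V)), C ∈ F → RT M C D' F' → Disjoint D' (S ∪ D) →
    ∃ F'', RT M S (D ∪ D') F'' ∧ F ⊆ F'' ∧ F' ⊆ F'' := by
  induction h with
  | leaf S hS =>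
    intro C D' F' hC h' hd
    obtain rfl : C = S := hC
    refine ⟨_, RT.join C ∅ D' {C} F' (RT.leaf C hS) h' (by simp), ?_, ?_⟩ <;> simp
  | forget S D F a h ha haD hc ih =>
    intro C D' F' hC h' hd
    rcases hC with rfl | hC
    · refine ⟨_, RT.join _ D D' _ F' (RT.forget S D F a h ha haD hc) h' ?_,
        Set.subset_union_left, Set.subset_union_right⟩
      rw [Finset.disjoint_union_right] at hd
      exact hd.2.symm
    · rw [Finset.disjoint_union_right, Finset.disjoint_insert_right] at hd
      obtain ⟨F'', r, s1, s2⟩ := ih C D' F' hC h'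
        (by rw [Finset.disjoint_union_right]; exact ⟨hd.1.2, hd.2⟩)
      refine ⟨_, RT.forget S _ F'' a r ha ?_ hc, Set.insert_subset_insert s1,
        s2.trans (Set.subset_insert _ _)⟩
      simp only [Finset.mem_union, not_or]
      exact ⟨haD, hd.1.1⟩
  | intro S D F v h hv ih =>
    intro C D' F' hC h' hd
    rcases hC with rfl | hC
    · refine ⟨_, RT.join _ _ D' _ F' (RT.intro _ D F v h hv) h' ?_,
        Set.subset_union_left, Set.subset_union_right⟩
      rw [Finset.disjoint_union_right] at hd
      exact hd.2.symm
    · obtain ⟨F'', r, s1, s2⟩ := ih C D' F' hC h' (by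
        rwa [Finset.insert_union, ← Finset.union_insert])
      rw [Finset.insert_union]
      exact ⟨_, RT.intro S _ F'' v r hv, Set.insert_subset_insert s1,
        s2.trans (Set.subset_insert _ _)⟩
  | join S D1 D2 F1 F2 h1 h2 hd ih1 ih2 =>
    intro C D' F' hC h' hd'
    rw [Finset.disjoint_union_right, Finset.disjoint_union_right] at hd'
    rcases hC with hC | hC
    · obtain ⟨F'', r, s1, s2⟩ := ih1 C D' F' hC h'
        (by rw [Finset.disjoint_union_right]; exact ⟨hd'.1, hd'.2.1⟩)
      refine ⟨F'' ∪ F2, ?_, Set.union_subset_union_left _ s1, s2.trans Set.subset_union_left⟩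
      have := RT.join S _ D2 F'' F2 r h2
        (by rw [Finset.disjoint_union_left]; exact ⟨hd, hd'.2.2⟩)
      rwa [Finset.union_right_comm] at this
    · obtain ⟨F'', r, s1, s2⟩ := ih2 C D' F' hC h'
        (by rw [Finset.disjoint_union_right]; exact ⟨hd'.1, hd'.2.2⟩)
      refine ⟨F1 ∪ F'', ?_, Set.union_subset_union_right _ s1, s2.trans Set.subset_union_right⟩
      have := RT.join S D1 _ F1 F'' h1 r
        (by rw [Finset.disjoint_union_right]; exact ⟨hd, hd'.2.1.symm⟩)
      rwa [← Finset.union_assoc] at this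

theorem RT.introMany {B : Finset V} (K D : Finset V) :
    ∀ (F : Set (Finset V)), B ∈ F → Disjoint K D → RT M (K ∪ D) ∅ F →
    ∃ F', B ∈ F' ∧ RT M K D F' := by
  -- more general: peel vertices of D one by one
  suffices H : ∀ (D E : Finset V) (F : Set (Finset V)), B ∈ F → Disjoint K D →
      RT M (K ∪ D) E F → ∃ F', B ∈ F' ∧ RT M K (D ∪ E) F' by
    intro F hB hd h
    simpa using H D ∅ F hB hd h
  intro D
  induction D using Finset.induction_on with
  | empty => intro E F hB _ h; exact ⟨F, hB, by simpa using h⟩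
  | insert v D hv ih =>
    intro E F hB hd h
    rw [Finset.disjoint_insert_right] at hd
    rw [Finset.union_insert] at h
    have h2 := RT.intro (K ∪ D) E F v h (by simp [hv, hd.1])
    obtain ⟨F', hB', r⟩ := ih (insert v E) _ (Or.inr hB) hd.2 h2
    refine ⟨F', hB', ?_⟩
    rwa [Finset.insert_union, ← Finset.union_insert]

theorem RT.forgetMany {B : Finset V} (A : Finset V) :
    ∀ (S D : Finset V) (F : Set (Finset V)), B ∈ F → Disjoint A S → Disjoint A D →
    RT M S D F → (A ∪ S).card ≤ M → ∃ F', B ∈ F' ∧ RT M (A ∪ S) D F' := by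
  induction A using Finset.induction_on with
  | empty => intro S D F hB _ _ h _; exact ⟨F, hB, by simpa using h⟩
  | insert v A hv ih =>
    intro S D F hB h1 h2 h hc
    rw [Finset.disjoint_insert_left] at h1 h2
    rw [Finset.insert_union] at hc
    obtain ⟨F', hB', r⟩ := ih S D F hB h1.2 h2.2 h
      ((Finset.card_le_card (Finset.subset_insert _ _)).trans hc)
    rw [Finset.insert_union]
    exact ⟨_, Or.inr hB', RT.forget _ D F' v r (by simp [hv, h1.1]) h2.1 hc⟩

theorem RT.newBag (C B : Finset V) (hC : C.card ≤ M) (hB : B.card ≤ M) :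
    ∃ F, B ∈ F ∧ RT M C (B \ C) F := by
  obtain ⟨F, h1, h2⟩ := RT.introMany (M := M) (B := B) (B ∩ C) (B \ C) {B} rfl
    (Finset.disjoint_left.2 (by simp +contextual)) (by
      have : B ∩ C ∪ B \ C = B := by ext; simp; tauto
      rw [this]; exact RT.leaf B hB)
  obtain ⟨F', h3, h4⟩ := RT.forgetMany (M := M) (B := B) (C \ B) (B ∩ C) (B \ C) F h1
    (Finset.disjoint_left.2 (by simp +contextual))
    (Finset.disjoint_left.2 (by simp +contextual)) h2 (by
      have : C \ B ∪ B ∩ C = C := by ext; simp; tauto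
      rw [this]; exact hC)
  have : C \ B ∪ B ∩ C = C := by ext; simp; tauto
  rw [this] at h4
  exact ⟨F', h3, h4⟩

set_option maxHeartbeats 2000000 in
/-- The three-way separation: root bag minus `S'` lies in the special part `U`. -/
theorem RT.sep {S D : Finset V} {F : Set (Finset V)} (h : RT M S D F) :
    ∀ p : ℕ, p + M ≤ (S ∪ D).card →
    ∃ S' U L1 L2 : Finset V, S'.card = M ∧ Disjoint S' U ∧ Disjoint S' L1 ∧ Disjoint S' L2 ∧
      Disjoint U L1 ∧ Disjoint U L2 ∧ Disjoint L1 L2 ∧ S' ∪ U ∪ L1 ∪ L2 = S ∪ D ∧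
      S ⊆ S' ∪ U ∧ L1.card ≤ p ∧ L2.card ≤ p ∧ U.card + p + M ≤ (S ∪ D).card ∧
      ∀ C ∈ F, C ⊆ S' ∪ U ∨ C ⊆ S' ∪ L1 ∨ C ⊆ S' ∪ L2 := by
  induction h with
  | leaf S hS =>
    intro p hp
    simp only [Finset.union_empty] at hp ⊢
    refine ⟨S, ∅, ∅, ∅, ?_⟩
    have : S.card = M := by omega
    have : p = 0 := by omega
    subst this
    simp [*]
  | forget S D F a h ha haD hc ih =>
    intro p hp
    obtain ⟨b1, b2, b3, b4, b5⟩ := h.basic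
    have hcard : (insert a S ∪ D).card = (S ∪ D).card + 1 := by
      rw [Finset.insert_union, Finset.card_insert_of_notMem (by simp [ha, haD])]
    by_cases hp' : p + M ≤ (S ∪ D).card
    · obtain ⟨S', U, L1, L2, c1, d1, d2, d3, d4, d5, d6, e, s, l1, l2, u, bags⟩ := ih p hp'
      have haN : a ∉ S' ∪ U ∪ L1 ∪ L2 := by rw [e]; simp [ha, haD]
      simp only [Finset.mem_union, not_or] at haN
      refine ⟨S', insert a U, L1, L2, c1, ?_, d2, d3, ?_, ?_, d6, ?_, ?_, l1, l2, ?_, ?_⟩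
      · rw [Finset.disjoint_insert_right]; tauto
      · rw [Finset.disjoint_insert_left]; tauto
      · rw [Finset.disjoint_insert_left]; tauto
      · rw [Finset.insert_union, ← e]; ext x; simp only [Finset.mem_union, Finset.mem_insert]; tauto
      · rw [Finset.union_insert]; exact Finset.insert_subset_insert _ s
      · rw [Finset.card_insert_of_notMem (by tauto)]; omega
      · rintro C (rfl | hC)
        · left; rw [Finset.union_insert]; exact Finset.insert_subset_insert _ s
        · rcases bags C hC with h | h | h
          · left; rw [Finset.union_insert]; exact h.trans (Finset.subset_insert _ _)
          · right; left; exact h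
          · right; right; exact h
    · have hd : Disjoint (insert a S) D := by rw [Finset.disjoint_insert_left]; exact ⟨haD, b2⟩
      rw [Finset.card_union_of_disjoint hd] at *
      obtain ⟨P, hP, hPc⟩ := Finset.exists_subset_card_eq (s := D)
        (n := M - (insert a S).card) (by omega)
      have hdP : Disjoint (insert a S) P := hd.mono_right hP
      have hsd := Finset.card_sdiff_add_card_eq_card hP
      have hun : insert a S ∪ P ∪ D \ P = insert a S ∪ D := by
        rw [Finset.union_assoc, Finset.union_sdiff_of_subset hP]
      refine ⟨insert a S ∪ P, ∅, D \ P, ∅, ?_, by simp, ?_, by simp, by simp, by simp, by simp, ?_,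
        ?_, ?_, by simp, ?_, ?_⟩
      · rw [Finset.card_union_of_disjoint hdP]; omega
      · rw [Finset.disjoint_union_left]
        exact ⟨hd.mono_right Finset.sdiff_subset, Finset.disjoint_sdiff⟩
      · simpa using hun
      · simp
      · omega
      · simp; omega
      · rintro C (rfl | hC)
        · left; simp
        · right; left; rw [hun]
          refine (b3 C hC).trans (Finset.union_subset_union_left (Finset.subset_insert _ _))
  | intro S D F v h hv ih =>
    intro p hp
    have hE : S ∪ insert v D = insert v S ∪ D := by
      rw [Finset.insert_union, Finset.union_insert]
    rw [hE] at hp ⊢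
    obtain ⟨S', U, L1, L2, c1, d1, d2, d3, d4, d5, d6, e, s, l1, l2, u, bags⟩ := ih p hp
    have s' : S ⊆ S' ∪ U := (Finset.subset_insert v S).trans s
    refine ⟨S', U, L1, L2, c1, d1, d2, d3, d4, d5, d6, e, s', l1, l2, u, ?_⟩
    rintro C (rfl | hC)
    · left; exact s'
    · exact bags C hC
  | join S D1 D2 F1 F2 h1 h2 hd ih1 ih2 =>
    -- the case where one side is large
    have big : ∀ (D1 D2 : Finset V) (F1 F2 : Set (Finset V)), RT M S D1 F1 → RT M S D2 F2 →
      Disjoint D1 D2 → ∀ p : ℕ,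
      (∃ S' U L1 L2 : Finset V, S'.card = M ∧ Disjoint S' U ∧ Disjoint S' L1 ∧ Disjoint S' L2 ∧
      Disjoint U L1 ∧ Disjoint U L2 ∧ Disjoint L1 L2 ∧ S' ∪ U ∪ L1 ∪ L2 = S ∪ D1 ∧
      S ⊆ S' ∪ U ∧ L1.card ≤ p ∧ L2.card ≤ p ∧ U.card + p + M ≤ (S ∪ D1).card ∧
      ∀ C ∈ F1, C ⊆ S' ∪ U ∨ C ⊆ S' ∪ L1 ∨ C ⊆ S' ∪ L2) →
      ∃ S' U L1 L2 : Finset V, S'.card = M ∧ Disjoint S' U ∧ Disjoint S' L1 ∧ Disjoint S' L2 ∧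
      Disjoint U L1 ∧ Disjoint U L2 ∧ Disjoint L1 L2 ∧ S' ∪ U ∪ L1 ∪ L2 = S ∪ (D1 ∪ D2) ∧
      S ⊆ S' ∪ U ∧ L1.card ≤ p ∧ L2.card ≤ p ∧ U.card + p + M ≤ (S ∪ (D1 ∪ D2)).card ∧
      ∀ C ∈ F1 ∪ F2, C ⊆ S' ∪ U ∨ C ⊆ S' ∪ L1 ∨ C ⊆ S' ∪ L2 := by
      intro D1 D2 F1 F2 h1 h2 hd p hh
      obtain ⟨S', U, L1, L2, c1, d1, d2, d3, d4, d5, d6, e, s, l1, l2, u, bags⟩ := hh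
      obtain ⟨a1, a2, a3, a4, a5⟩ := h1.basic
      obtain ⟨b1, b2, b3, b4, b5⟩ := h2.basic
      have hD : Disjoint (S' ∪ U ∪ L1 ∪ L2) D2 := by
        rw [e, Finset.disjoint_union_left]; exact ⟨b2, hd⟩
      simp only [Finset.disjoint_union_left] at hD
      obtain ⟨⟨⟨g1, g2⟩, g3⟩, g4⟩ := hD
      refine ⟨S', U ∪ D2, L1, L2, c1, ?_, d2, d3, ?_, ?_, d6, ?_, ?_, l1, l2, ?_, ?_⟩
      · rw [Finset.disjoint_union_right]; exact ⟨d1, g1⟩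
      · rw [Finset.disjoint_union_left]; exact ⟨d4, g3.symm⟩
      · rw [Finset.disjoint_union_left]; exact ⟨d5, g4.symm⟩
      · rw [← Finset.union_assoc S, ← e]; ext x; simp only [Finset.mem_union]; tauto
      · rw [← Finset.union_assoc]; exact s.trans Finset.subset_union_left
      · rw [← Finset.union_assoc S, Finset.card_union_of_disjoint g2,
          Finset.card_union_of_disjoint (s := S ∪ D1)
            (by rw [Finset.disjoint_union_left]; exact ⟨b2, hd⟩)]
        omega
      · rintro C (hC | hC)
        · rcases bags C hC with h | h | h
          · left; rw [← Finset.union_assoc]; exact h.trans Finset.subset_union_left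
          · right; left; exact h
          · right; right; exact h
        · left
          rw [← Finset.union_assoc]
          exact (b3 C hC).trans (Finset.union_subset_union_left s)
    -- the case where both sides are small, one of them larger than `p`
    have mid : ∀ (D1 D2 : Finset V) (F1 F2 : Set (Finset V)), RT M S D1 F1 → RT M S D2 F2 →
      Disjoint D1 D2 → ∀ p : ℕ, (S ∪ D1).card < p + M → p ≤ D1.card →
      p + M ≤ (S ∪ (D1 ∪ D2)).card →
      ∃ S' U L1 L2 : Finset V, S'.card = M ∧ Disjoint S' U ∧ Disjoint S' L1 ∧ Disjoint S' L2 ∧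
      Disjoint U L1 ∧ Disjoint U L2 ∧ Disjoint L1 L2 ∧ S' ∪ U ∪ L1 ∪ L2 = S ∪ (D1 ∪ D2) ∧
      S ⊆ S' ∪ U ∧ L1.card ≤ p ∧ L2.card ≤ p ∧ U.card + p + M ≤ (S ∪ (D1 ∪ D2)).card ∧
      ∀ C ∈ F1 ∪ F2, C ⊆ S' ∪ U ∨ C ⊆ S' ∪ L1 ∨ C ⊆ S' ∪ L2 := by
      intro D1 D2 F1 F2 h1 h2 hd p hp1 hp2 hp
      obtain ⟨a1, a2, a3, a4, a5⟩ := h1.basic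
      obtain ⟨b1, b2, b3, b4, b5⟩ := h2.basic
      have hSD : Disjoint S (D1 ∪ D2) := by rw [Finset.disjoint_union_right]; exact ⟨a2, b2⟩
      rw [Finset.card_union_of_disjoint hSD, Finset.card_union_of_disjoint hd] at hp ⊢
      rw [Finset.card_union_of_disjoint a2] at hp1
      obtain ⟨P1, hP1, hc1⟩ := Finset.exists_subset_card_eq (s := D1)
        (n := D1.card - p) (by omega)
      obtain ⟨P2, hP2, hc2⟩ := Finset.exists_subset_card_eq (s := D2)
        (n := M - S.card - (D1.card - p)) (by omega)
      have hs1 := Finset.card_sdiff_add_card_eq_card hP1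
      have hs2 := Finset.card_sdiff_add_card_eq_card hP2
      have q1 : Disjoint S P1 := a2.mono_right hP1
      have q2 : Disjoint S P2 := b2.mono_right hP2
      have q3 : Disjoint P1 P2 := hd.mono hP1 hP2
      have r1 : P1 ∪ D1 \ P1 = D1 := Finset.union_sdiff_of_subset hP1
      have r2 : P2 ∪ D2 \ P2 = D2 := Finset.union_sdiff_of_subset hP2
      have t1 : D1 \ P1 ⊆ D1 := Finset.sdiff_subset
      have t2 : D2 \ P2 ⊆ D2 := Finset.sdiff_subset
      refine ⟨S ∪ P1 ∪ P2, D2 \ P2, D1 \ P1, ∅, ?_, ?_, ?_, by simp, ?_, by simp, by simp, ?_,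
        ?_, ?_, by simp, ?_, ?_⟩
      · rw [Finset.card_union_of_disjoint (by rw [Finset.disjoint_union_left]; exact ⟨q2, q3⟩),
          Finset.card_union_of_disjoint q1]
        omega
      · simp only [Finset.disjoint_union_left]
        exact ⟨⟨b2.mono_right t2, hd.mono hP1 t2⟩, Finset.disjoint_sdiff⟩
      · simp only [Finset.disjoint_union_left]
        exact ⟨⟨a2.mono_right t1, Finset.disjoint_sdiff⟩, (hd.mono t1 hP2).symm⟩
      · exact (hd.mono t1 t2).symm
      · conv_rhs => rw [← r1, ← r2]
        ext x; simp only [Finset.mem_union, Finset.notMem_empty]; tauto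
      · intro x hx; simp [hx]
      · omega
      · omega
      · rintro C (hC | hC)
        · right; left
          refine (a3 C hC).trans ?_
          rw [← r1]
          intro x; simp only [Finset.mem_union, Finset.mem_sdiff]; tauto
        · left
          refine (b3 C hC).trans ?_
          rw [← r2]
          intro x; simp only [Finset.mem_union, Finset.mem_sdiff]; tauto
    intro p hp
    by_cases k1 : p + M ≤ (S ∪ D1).card
    · exact big D1 D2 F1 F2 h1 h2 hd p (ih1 p k1)
    by_cases k2 : p + M ≤ (S ∪ D2).card
    · have := big D2 D1 F2 F1 h2 h1 hd.symm p (ih2 p k2)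
      rwa [Finset.union_comm D2 D1, Set.union_comm F2 F1] at this
    by_cases k3 : p ≤ D1.card
    · exact mid D1 D2 F1 F2 h1 h2 hd p (by omega) k3 hp
    by_cases k4 : p ≤ D2.card
    · have := mid D2 D1 F2 F1 h2 h1 hd.symm p (by omega) k4 (by rwa [Finset.union_comm D2 D1])
      rwa [Finset.union_comm D2 D1, Set.union_comm F2 F1] at this
    · obtain ⟨a1, a2, a3, a4, a5⟩ := h1.basic
      obtain ⟨b1, b2, b3, b4, b5⟩ := h2.basic
      have hSD : Disjoint S (D1 ∪ D2) := by rw [Finset.disjoint_union_right]; exact ⟨a2, b2⟩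
      rw [Finset.card_union_of_disjoint hSD] at hp ⊢
      obtain ⟨P, hP, hPc⟩ := Finset.exists_subset_card_eq (s := D1 ∪ D2)
        (n := M - S.card) (by omega)
      have t1 : D1 \ P ⊆ D1 := Finset.sdiff_subset
      have t2 : D2 \ P ⊆ D2 := Finset.sdiff_subset
      refine ⟨S ∪ P, ∅, D1 \ P, D2 \ P, ?_, by simp, ?_, ?_, by simp, by simp, hd.mono t1 t2, ?_,
        ?_, ?_, ?_, ?_, ?_⟩
      · rw [Finset.card_union_of_disjoint (hSD.mono_right hP)]; omega
      · rw [Finset.disjoint_union_left]; exact ⟨a2.mono_right t1, Finset.disjoint_sdiff⟩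
      · rw [Finset.disjoint_union_left]; exact ⟨b2.mono_right t2, Finset.disjoint_sdiff⟩
      · ext x
        have := @hP x
        simp only [Finset.mem_union, Finset.mem_sdiff, Finset.notMem_empty] at *
        tauto
      · intro x hx; simp [hx]
      · have := Finset.card_le_card t1; omega
      · have := Finset.card_le_card t2; omega
      · simp; omega
      · rintro C (hC | hC)
        · right; left
          refine (a3 C hC).trans ?_
          intro x; simp only [Finset.mem_union, Finset.mem_sdiff]; tauto
        · right; right
          refine (b3 C hC).trans ?_
          intro x; simp only [Finset.mem_union, Finset.mem_sdiff]; tauto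

end RTsec

/-- In a tree decomposition, attaching a new tree-node `y` adjacent to `x` in a connected `J`. -/
theorem bag_inter_sub {ι : Type} {T : SimpleGraph ι} (hT : T.IsTree)
    {J : Set ι} (hJ : (T.induce J).Connected) {x y z : ι} (hx : x ∈ J) (hy : y ∉ J)
    (hz : z ∈ J) (hxy : T.Adj y x) {A : Set ι} (hA : (T.induce A).Connected)
    (hyA : y ∈ A) (hzA : z ∈ A) : x ∈ A := by
  classical
  obtain ⟨p, hp⟩ := (hJ.preconnected ⟨x, hx⟩ ⟨z, hz⟩).exists_isPath
  obtain ⟨q, hq⟩ := (hA.preconnected ⟨y, hyA⟩ ⟨z, hzA⟩).exists_isPath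
  let p' := p.map (SimpleGraph.Embedding.induce J).toHom
  let q' := q.map (SimpleGraph.Embedding.induce A).toHom
  have hp' : p'.IsPath := hp.map (f := (SimpleGraph.Embedding.induce (G := T) J).toHom)
    (SimpleGraph.Embedding.induce (G := T) J).injective
  have hq' : q'.IsPath := hq.map (f := (SimpleGraph.Embedding.induce (G := T) A).toHom)
    (SimpleGraph.Embedding.induce (G := T) A).injective
  have hpJ : ∀ v ∈ p'.support, v ∈ J := by
    intro v hv
    simp only [p', SimpleGraph.Walk.support_map, List.mem_map] at hv
    obtain ⟨u, _, rfl⟩ := hv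
    exact u.2
  have hqA : ∀ v ∈ q'.support, v ∈ A := by
    intro v hv
    simp only [q', SimpleGraph.Walk.support_map, List.mem_map] at hv
    obtain ⟨u, _, rfl⟩ := hv
    exact u.2
  let r : T.Walk y z := SimpleGraph.Walk.cons hxy p'
  have hr : r.IsPath := by
    exact (SimpleGraph.Walk.cons_isPath_iff hxy p').2 ⟨hp', fun h => hy (hpJ _ h)⟩
  have : r = q' := congrArg Subtype.val (hT.isAcyclic.path_unique ⟨r, hr⟩ ⟨q', hq'⟩)
  apply hqA
  rw [← this]
  exact List.mem_cons_of_mem _ p'.start_mem_support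

theorem exists_RT {V : Type} [DecidableEq V] (G : SimpleGraph V) (w : ℕ)
    (htw : TreewidthLE G w) (Q : Finset V) :
    ∃ S D F, RT (w + 1) S D F ∧ S ∪ D = Q ∧
      ∀ u v, G.Adj u v → u ∈ Q → v ∈ Q → ∃ C ∈ F, u ∈ C ∧ v ∈ C := by
  classical
  obtain ⟨ι, _, T, B, ⟨hT, hcov, hedge, hconn⟩, hcard⟩ := htw
  have key : ∀ k : ℕ, k + 1 ≤ Fintype.card ι → ∃ J : Finset ι, J.card = k + 1 ∧
      (T.induce (J : Set ι)).Connected ∧ ∃ S D F, RT (w + 1) S D F ∧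
      S ∪ D = J.biUnion (fun x => B x ∩ Q) ∧ ∀ x ∈ J, ∃ C ∈ F, B x ∩ Q ⊆ C := by
    intro k
    induction k with
    | zero =>
      intro _
      obtain ⟨x⟩ := hT.connected.nonempty
      refine ⟨{x}, by simp, ?_, B x ∩ Q, ∅, {B x ∩ Q}, RT.leaf _ ?_, by simp, by simp⟩
      · rw [Finset.coe_singleton]
        exact SimpleGraph.Connected.mk (fun a b => by
          have : a = b := Subsingleton.elim _ _
          rw [this])
      · exact (Finset.card_le_card Finset.inter_subset_left).trans (hcard x)
    | succ k ih =>
      intro hk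
      obtain ⟨J, hJ, hJc, S, D, F, hR, hSD, hF⟩ := ih (by omega)
      obtain ⟨y0, hy0⟩ : ∃ y, y ∉ J := by
        by_contra! hall
        have : J = Finset.univ := Finset.eq_univ_iff_forall.2 hall
        rw [this, Finset.card_univ] at hJ
        omega
      obtain ⟨x0, hx0⟩ : J.Nonempty := by
        rw [← Finset.card_pos]; omega
      obtain ⟨p⟩ := hT.connected.preconnected x0 y0
      obtain ⟨d, -, hd1, hd2⟩ := p.exists_boundary_dart (J : Set ι) hx0 hy0
      obtain ⟨⟨x, y⟩, hxy⟩ := d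
      simp only [Finset.mem_coe] at hd1 hd2 hxy
      have hsub : ∀ v ∈ B y, v ∈ S ∪ D → v ∈ B x ∩ Q := by
        intro v hv hv2
        rw [hSD] at hv2
        simp only [Finset.mem_biUnion, Finset.mem_inter] at hv2 ⊢
        obtain ⟨z, hzJ, hzB, hvQ⟩ := hv2
        refine ⟨?_, hvQ⟩
        exact bag_inter_sub hT hJc (x := x) (y := y) (z := z) hd1 (by simpa using hd2) hzJ hxy.symm
          (hconn v) hv hzB
      obtain ⟨C, hCF, hC⟩ := hF x hd1
      obtain ⟨b1, b2, b3, b4, b5⟩ := hR.basic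
      obtain ⟨F', hBF', hR'⟩ := RT.newBag (M := w + 1) C (B y ∩ Q) (b4 C hCF)
        ((Finset.card_le_card Finset.inter_subset_left).trans (hcard y))
      obtain ⟨F'', hR'', s1, s2⟩ := hR.graft C _ F' hCF hR' (by
        rw [Finset.disjoint_left]
        intro v hv hv2
        simp only [Finset.mem_sdiff, Finset.mem_inter] at hv
        exact hv.2 (hC (hsub v hv.1.1 hv2)))
      refine ⟨insert y J, by rw [Finset.card_insert_of_notMem hd2, hJ], ?_, S, _, F'', hR'', ?_, ?_⟩
      · have h2 : (T.induce {x, y}).Connected := SimpleGraph.induce_pair_connected_of_adj hxy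
        have := SimpleGraph.induce_union_connected
          hJc.preconnected h2.preconnected ⟨x, hd1, Set.mem_insert x {y}⟩
        have e : (↑(insert y J) : Set ι) = (J : Set ι) ∪ {x, y} := by
          ext z; simp only [Finset.coe_insert, Set.mem_insert_iff, Set.mem_union,
            Finset.mem_coe, Set.mem_singleton_iff]
          constructor
          · tauto
          · rintro (h | rfl | h) <;> tauto
        rw [e]; exact this
      · rw [Finset.biUnion_insert, ← hSD, ← Finset.union_assoc]
        have hCS := b3 C hCF
        ext v
        have h3 := @hCS v
        simp only [Finset.mem_union, Finset.mem_sdiff, Finset.mem_inter] at h3 ⊢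
        tauto
      · intro z hz
        rw [Finset.mem_insert] at hz
        rcases hz with rfl | hz
        · exact ⟨_, s2 hBF', subset_rfl⟩
        · obtain ⟨C', h1, h2⟩ := hF z hz
          exact ⟨C', s1 h1, h2⟩
  have hpos : 0 < Fintype.card ι := Fintype.card_pos_iff.2 hT.connected.nonempty
  obtain ⟨J, hJ, -, S, D, F, hR, hSD, hF⟩ := key (Fintype.card ι - 1) (by omega)
  have hJu : J = Finset.univ := by
    rw [← Finset.card_eq_iff_eq_univ]; omega
  subst hJu
  refine ⟨S, D, F, hR, ?_, ?_⟩
  · rw [hSD]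
    ext v
    have := hcov v
    simp only [Finset.mem_biUnion, Finset.mem_univ, true_and, Finset.mem_inter]
    constructor
    · rintro ⟨x, _, h⟩; exact h
    · intro h; obtain ⟨x, hx⟩ := this; exact ⟨x, hx, h⟩
  · intro u v huv hu hv
    obtain ⟨x, h1, h2⟩ := hedge u v huv
    obtain ⟨C, hC, hs⟩ := hF x (Finset.mem_univ x)
    exact ⟨C, hC, hs (by simp [h1, hu]), hs (by simp [h2, hv])⟩

/-- No edges between two sets (in either direction). -/
def NoEdge {V : Type} (G : SimpleGraph V) (A B : Finset V) : Prop :=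
  ∀ u v : V, G.Adj u v → ¬ (u ∈ A ∧ v ∈ B)

theorem NoEdge.symm {V : Type} {G : SimpleGraph V} {A B : Finset V} (h : NoEdge G A B) :
    NoEdge G B A := fun u v huv hh => h v u huv.symm ⟨hh.2, hh.1⟩

theorem NoEdge.empty_left {V : Type} {G : SimpleGraph V} {A : Finset V} : NoEdge G ∅ A :=
  fun u v _ h => by simp at h

theorem NoEdge.empty_right {V : Type} {G : SimpleGraph V} {A : Finset V} : NoEdge G A ∅ :=
  fun u v _ h => by simp at h

/-- A three-way separation of `Q`. -/
structure Tri {V : Type} [DecidableEq V] (G : SimpleGraph V) (Q S A B C : Finset V) : Prop where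
  hSA : Disjoint S A
  hSB : Disjoint S B
  hSC : Disjoint S C
  hAB : Disjoint A B
  hAC : Disjoint A C
  hBC : Disjoint B C
  un : S ∪ A ∪ B ∪ C = Q
  eAB : NoEdge G A B
  eAC : NoEdge G A C
  eBC : NoEdge G B C

theorem Tri.card {V : Type} [DecidableEq V] {G : SimpleGraph V} {Q S A B C : Finset V}
    (h : Tri G Q S A B C) : S.card + A.card + B.card + C.card = Q.card := by
  rw [← h.un, Finset.card_union_of_disjoint, Finset.card_union_of_disjoint,
    Finset.card_union_of_disjoint h.hSA]
  · rw [Finset.disjoint_union_left]; exact ⟨h.hSB, h.hAB⟩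
  · simp only [Finset.disjoint_union_left]; exact ⟨⟨h.hSC, h.hAC⟩, h.hBC⟩

theorem Tri.rot {V : Type} [DecidableEq V] {G : SimpleGraph V} {Q S A B C : Finset V}
    (h : Tri G Q S A B C) : Tri G Q S B C A where
  hSA := h.hSB
  hSB := h.hSC
  hSC := h.hSA
  hAB := h.hBC
  hAC := h.hAB.symm
  hBC := h.hAC.symm
  un := by rw [← h.un]; ext x; simp only [Finset.mem_union]; tauto
  eAB := h.eBC
  eAC := h.eAB.symm
  eBC := h.eAC.symm

theorem Tri.swap {V : Type} [DecidableEq V] {G : SimpleGraph V} {Q S A B C : Finset V}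
    (h : Tri G Q S A B C) : Tri G Q S B A C where
  hSA := h.hSB
  hSB := h.hSA
  hSC := h.hSC
  hAB := h.hAB.symm
  hAC := h.hBC
  hBC := h.hAC
  un := by rw [← h.un]; ext x; simp only [Finset.mem_union]; tauto
  eAB := h.eAB.symm
  eAC := h.eBC
  eBC := h.eAC

theorem exists_sep {V : Type} [DecidableEq V] (G : SimpleGraph V) (w : ℕ)
    (htw : TreewidthLE G w) (Q : Finset V) (p : ℕ) (hp : p + (w + 1) ≤ Q.card) :
    ∃ S L1 L2 U : Finset V, Tri G Q S L1 L2 U ∧ S.card = w + 1 ∧ L2.card ≤ L1.card ∧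
      L1.card ≤ p ∧ U.card + p + (w + 1) ≤ Q.card := by
  obtain ⟨S, D, F, hR, hSD, hE⟩ := exists_RT G w htw Q
  obtain ⟨S', U, L1, L2, c1, d1, d2, d3, d4, d5, d6, e, s, l1, l2, u, bags⟩ :=
    hR.sep p (by rwa [hSD])
  rw [hSD] at e u
  have ne : ∀ A B : Finset V, A ⊆ Q → B ⊆ Q → Disjoint A B → Disjoint S' A → Disjoint S' B →
      (∀ C ∈ F, C ∩ A = ∅ ∨ C ∩ B = ∅) → NoEdge G A B := by
    intro A B hA hB _ _ _ h u v huv ⟨hu, hv⟩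
    obtain ⟨C, hC, h1, h2⟩ := hE u v huv (hA hu) (hB hv)
    rcases h C hC with h | h
    · have : u ∈ C ∩ A := by simp [h1, hu]
      rw [h] at this; simp at this
    · have : v ∈ C ∩ B := by simp [h2, hv]
      rw [h] at this; simp at this
  have hU : U ⊆ Q := by rw [← e]; intro x hx; simp [hx]
  have hL1 : L1 ⊆ Q := by rw [← e]; intro x hx; simp [hx]
  have hL2 : L2 ⊆ Q := by rw [← e]; intro x hx; simp [hx]
  have emp : ∀ (C P A : Finset V), C ⊆ S' ∪ P → Disjoint S' A → Disjoint P A → C ∩ A = ∅ := by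
    intro C P A h h1 h2
    rw [← Finset.disjoint_iff_inter_eq_empty]
    exact (Finset.disjoint_union_left.2 ⟨h1, h2⟩).mono_left h
  have tri : Tri G Q S' L1 L2 U := by
    refine ⟨d2, d3, d1, d6, d4.symm, d5.symm, ?_, ?_, ?_, ?_⟩
    · rw [← e]; ext x; simp only [Finset.mem_union]; tauto
    · refine ne _ _ hL1 hL2 d6 d2 d3 fun C hC => ?_
      rcases bags C hC with h | h | h
      · exact Or.inl (emp _ _ _ h d2 d4)
      · exact Or.inr (emp _ _ _ h d3 d6)
      · exact Or.inl (emp _ _ _ h d2 d6.symm)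
    · refine ne _ _ hL1 hU d4.symm d2 d1 fun C hC => ?_
      rcases bags C hC with h | h | h
      · exact Or.inl (emp _ _ _ h d2 d4)
      · exact Or.inr (emp _ _ _ h d1 d4.symm)
      · exact Or.inl (emp _ _ _ h d2 d6.symm)
    · refine ne _ _ hL2 hU d5.symm d3 d1 fun C hC => ?_
      rcases bags C hC with h | h | h
      · exact Or.inl (emp _ _ _ h d3 d5)
      · exact Or.inl (emp _ _ _ h d3 d6)
      · exact Or.inr (emp _ _ _ h d1 d5.symm)
  rcases le_total L2.card L1.card with h | h
  · exact ⟨S', L1, L2, U, tri, c1, h, l1, u⟩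
  · exact ⟨S', L2, L1, U, tri.swap, c1, h, l2, u⟩

theorem delta_lower (N X a k : ℕ) (hN : 0 < N) (h : X + k * N ≤ a) :
    X + k * N + N ≤ a + delta N X a := by
  unfold delta
  rw [if_neg (by have := Nat.zero_le (k * N); omega)]
  have h1 := Nat.mod_add_div (a - X) N
  have h2 := Nat.mod_lt (a - X) hN
  have h3 : k ≤ (a - X) / N := by
    rw [Nat.le_div_iff_mul_le hN]; omega
  have h4 : k * N ≤ N * ((a - X) / N) := by
    rw [mul_comm]; exact Nat.mul_le_mul_left N h3
  omega

theorem delta_pos (N X a : ℕ) (hN : 0 < N) : 1 ≤ delta N X a := by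
  unfold delta
  have h2 := Nat.mod_lt (a - X) hN
  split_ifs <;> omega

/-- For `w ≥ 1`, `X > 0`, `N ≥ max(X, w + 1)` and a graph `G` with treewidth at most
`w` and `5N + X + 2w + 3 ≤ |G| ≤ 8N + X + 3w + 3`, there are a set `S₁` of exactly
`w + 1` vertices, a partition of `G` minus `S₁` into parts `G₁, G₂, G₄, Ḡ`, a set
`S₂ ⊆ Ḡ` of exactly `w + 1` vertices and a partition of `Ḡ` minus `S₂` into parts
`G₃, G₅, G₆`, with `|G₁| ≤ 2N + X`, `|G₁| + |G₂| ≥ (3/2)N + X` and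
`|Gᵢ| ≤ 2N + Δ(|G₁| + ⋯ + |G_{i-1}|) + Iᵢ` for `2 ≤ i ≤ 6`, where
`I₆ = |G| - (8N + X + 2w + 2)` if `|G| = 8N + X + 2w + 2 + c` for some
`1 ≤ c ≤ w + 1`, and `Iᵢ = 0` otherwise. -/
theorem stmt_11 {V : Type} [Fintype V] [DecidableEq V]
    (G : SimpleGraph V) (w : ℕ) (hw : 1 ≤ w) (htw : TreewidthLE G w)
    (N X : ℕ) (hX : 0 < X) (hN : max X (w + 1) ≤ N)
    (hlow : 5 * N + X + 2 * w + 3 ≤ Fintype.card V)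
    (hhigh : Fintype.card V ≤ 8 * N + X + 3 * w + 3) :
    ∃ (S1 G1 G2 G4 Gbar S2 G3 G5 G6 : Finset V),
      S1.card = w + 1 ∧
      -- partition of G minus S₁ into G₁, G₂, G₄, Ḡ
      (Disjoint G1 G2 ∧ Disjoint G1 G4 ∧ Disjoint G1 Gbar ∧
        Disjoint G2 G4 ∧ Disjoint G2 Gbar ∧ Disjoint G4 Gbar) ∧
      G1 ∪ G2 ∪ G4 ∪ Gbar = Finset.univ \ S1 ∧
      (∀ u v : V, G.Adj u v →
        ¬(u ∈ G1 ∧ v ∈ G2) ∧ ¬(u ∈ G1 ∧ v ∈ G4) ∧ ¬(u ∈ G1 ∧ v ∈ Gbar) ∧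
        ¬(u ∈ G2 ∧ v ∈ G4) ∧ ¬(u ∈ G2 ∧ v ∈ Gbar) ∧ ¬(u ∈ G4 ∧ v ∈ Gbar)) ∧
      -- partition of Ḡ minus S₂ into G₃, G₅, G₆
      S2 ⊆ Gbar ∧ S2.card = w + 1 ∧
      (Disjoint G3 G5 ∧ Disjoint G3 G6 ∧ Disjoint G5 G6) ∧
      G3 ∪ G5 ∪ G6 = Gbar \ S2 ∧
      (∀ u v : V, G.Adj u v →
        ¬(u ∈ G3 ∧ v ∈ G5) ∧ ¬(u ∈ G3 ∧ v ∈ G6) ∧ ¬(u ∈ G5 ∧ v ∈ G6)) ∧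
      -- size conditions
      G1.card ≤ 2 * N + X ∧
      ((3 : ℝ) / 2 * N + X ≤ (G1.card : ℝ) + (G2.card : ℝ)) ∧
      G2.card ≤ 2 * N + delta N X G1.card ∧
      G3.card ≤ 2 * N + delta N X (G1.card + G2.card) ∧
      G4.card ≤ 2 * N + delta N X (G1.card + G2.card + G3.card) ∧
      G5.card ≤ 2 * N + delta N X (G1.card + G2.card + G3.card + G4.card) ∧
      G6.card ≤ 2 * N + delta N X (G1.card + G2.card + G3.card + G4.card + G5.card)
        + (Fintype.card V - (8 * N + X + 2 * w + 2)) := by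
  have hXN : X ≤ N := (le_max_left _ _).trans hN
  have hMN : w + 1 ≤ N := (le_max_right _ _).trans hN
  have hN0 : 0 < N := by omega
  by_contra hcon
  -- packaging
  have pack : ∀ (S1 G1 G2 G4 Gbar S2 G3 G5 G6 : Finset V),
      S1.card = w + 1 → S2.card = w + 1 →
      Disjoint S1 G1 → Disjoint S1 G2 → Disjoint S1 G4 → Disjoint S1 Gbar →
      Disjoint G1 G2 → Disjoint G1 G4 → Disjoint G1 Gbar →
      Disjoint G2 G4 → Disjoint G2 Gbar → Disjoint G4 Gbar →
      S1 ∪ G1 ∪ G2 ∪ G4 ∪ Gbar = Finset.univ →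
      NoEdge G G1 G2 → NoEdge G G1 G4 → NoEdge G G1 Gbar →
      NoEdge G G2 G4 → NoEdge G G2 Gbar → NoEdge G G4 Gbar →
      Tri G Gbar S2 G3 G5 G6 →
      G1.card ≤ 2 * N + X →
      3 * N + 2 * X ≤ 2 * (G1.card + G2.card) →
      G2.card ≤ 2 * N + delta N X G1.card →
      G3.card ≤ 2 * N + delta N X (G1.card + G2.card) →
      G4.card ≤ 2 * N + delta N X (G1.card + G2.card + G3.card) →
      G5.card ≤ 2 * N + delta N X (G1.card + G2.card + G3.card + G4.card) →
      X + 5 * N ≤ G1.card + G2.card + G3.card + G4.card + G5.card →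
      G1.card + G2.card + G3.card + G4.card + G5.card + G6.card + 2 * w + 2 ≤ Fintype.card V →
      False := by
    intro S1 G1 G2 G4 Gbar S2 G3 G5 G6 hS1 hS2 x1 x2 x4 x5 d12 d14 d1b d24 d2b d4b un
      e12 e14 e1b e24 e2b e4b tri g1 g12 g2 g3 g4 g5 g5' tot
    refine hcon ⟨S1, G1, G2, G4, Gbar, S2, G3, G5, G6, hS1, ⟨d12, d14, d1b, d24, d2b, d4b⟩, ?_,
      fun u v h => ⟨e12 u v h, e14 u v h, e1b u v h, e24 u v h, e2b u v h, e4b u v h⟩, ?_, hS2,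
      ⟨tri.hAB, tri.hAC, tri.hBC⟩, ?_,
      fun u v h => ⟨tri.eAB u v h, tri.eAC u v h, tri.eBC u v h⟩, g1, ?_, g2, g3, g4, g5, ?_⟩
    · rw [← un]
      have : Disjoint S1 (G1 ∪ G2 ∪ G4 ∪ Gbar) := by
        simp only [Finset.disjoint_union_right]; tauto
      rw [← Finset.union_sdiff_cancel_left this]
      congr 1
      ext x; simp only [Finset.mem_union]; tauto
    · rw [← tri.un]; intro x hx; simp [hx]
    · rw [← tri.un]
      have : Disjoint S2 (G3 ∪ G5 ∪ G6) := by
        simp only [Finset.disjoint_union_right]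
        exact ⟨⟨tri.hSA, tri.hSB⟩, tri.hSC⟩
      rw [← Finset.union_sdiff_cancel_left this]
      congr 1
      ext x; simp only [Finset.mem_union]; tauto
    · have : ((3 * N + 2 * X : ℕ) : ℝ) ≤ ((2 * (G1.card + G2.card) : ℕ) : ℝ) := by exact_mod_cast g12
      push_cast at this
      linarith
    · have := delta_lower N X _ 5 hN0 g5'
      omega
  obtain ⟨S1, L1, L2, U, t1, hS1, hl21, hl1, hu⟩ := exists_sep G w htw Finset.univ (2 * N + X)
    (by rw [Finset.card_univ]; omega)
  have hc1 := t1.card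
  rw [Finset.card_univ] at hc1 hu
  by_cases hgood : L2.card ≤ 2 * N + delta N X L1.card
  · -- `A = |L1| + |L2| ≥ 2N + X`
    set q := 5 * N + X - (L1.card + L2.card) with hq
    set R := U.card - (w + 1) with hRdef
    -- a suitable three-way separation of `U`
    obtain ⟨S2, P1, P2, P3, t2, hS2, k1, k2, k3, k4⟩ : ∃ S2 P1 P2 P3 : Finset V,
        Tri G U S2 P1 P2 P3 ∧ S2.card = w + 1 ∧ P1.card ≤ q ∧ P2.card ≤ P1.card ∧
        P2.card + q ≤ R ∧ P3.card + q ≤ R := by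
      by_cases hR : 2 * q ≤ R
      · obtain ⟨S2, P1, P2, P3, t2, hS2, a1, a2, a3⟩ := exists_sep G w htw U q (by omega)
        exact ⟨S2, P1, P2, P3, t2, hS2, a2, a1, by omega, by omega⟩
      · obtain ⟨S2, P1, P2, P3, t2, hS2, a1, a2, a3⟩ := exists_sep G w htw U (R - q) (by omega)
        rcases le_total P3.card P1.card with h | h
        · rcases le_total P3.card P2.card with h' | h'
          · exact ⟨S2, P1, P2, P3, t2, hS2, by omega, by omega, by omega, by omega⟩
          · exact ⟨S2, P1, P3, P2, t2.swap.rot, hS2, by omega,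
              by omega, by omega, by omega⟩
        · exact ⟨S2, P3, P1, P2, t2.rot.rot, hS2, by omega, by omega, by omega, by omega⟩
    have hc2 := t2.card
    have dl2 := delta_lower N X (L1.card + L2.card) 2 hN0 (by omega)
    by_cases hg : P2.card ≤ 2 * N + delta N X (L1.card + L2.card + P1.card)
    · refine pack S1 L1 L2 ∅ U S2 P1 P2 P3 hS1 hS2 t1.hSA t1.hSB (by simp) t1.hSC t1.hAB
        (by simp) t1.hAC (by simp) t1.hBC (by simp) (by simpa using t1.un) t1.eAB
        NoEdge.empty_right t1.eAC NoEdge.empty_right t1.eBC NoEdge.empty_left t2 hl1 (by omega)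
        hgood ?_ (by simp) (by simpa using hg) ?_ ?_
      · omega
      · simp only [Finset.card_empty]; omega
      · simp only [Finset.card_empty]; omega
    · have dp := delta_pos N X (L1.card + L2.card + P1.card) hN0
      have dl4 := delta_lower N X (L1.card + L2.card + P1.card) 4 hN0 (by omega)
      refine pack S1 L1 L2 ∅ U S2 P1 P3 P2 hS1 hS2 t1.hSA t1.hSB (by simp) t1.hSC t1.hAB
        (by simp) t1.hAC (by simp) t1.hBC (by simp) (by simpa using t1.un) t1.eAB
        NoEdge.empty_right t1.eAC NoEdge.empty_right t1.eBC NoEdge.empty_left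
        t2.swap.rot hl1 (by omega)
        hgood ?_ (by simp) ?_ ?_ ?_
      · omega
      · simp only [Finset.card_empty, add_zero]; omega
      · simp only [Finset.card_empty]; omega
      · simp only [Finset.card_empty]; omega
  · -- two nearly maximal pieces
    have dp := delta_pos N X L1.card hN0
    have dl1 := delta_lower N X L1.card 1 hN0 (by omega)
    have hlt : L1.card < 2 * N + X := by
      by_contra hcon2
      have := delta_lower N X L1.card 2 hN0 (by omega)
      omega
    obtain ⟨S2, P1, P2, P3, t2, hS2, a1, a2, a3⟩ := exists_sep G w htw U
      (5 * N + X - (L1.card + L2.card)) (by omega)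
    have hc2 := t2.card
    have dl3 := delta_lower N X (L1.card + P1.card) 2 hN0 (by omega)
    refine pack S1 L1 ∅ L2 U S2 P1 P2 P3 hS1 hS2 t1.hSA (by simp) t1.hSB t1.hSC (by simp) t1.hAB
      t1.hAC (by simp) (by simp) t1.hBC (by simpa using t1.un) NoEdge.empty_right t1.eAB
      t1.eAC NoEdge.empty_left NoEdge.empty_left t1.eBC t2 hl1 ?_ (by simp) ?_ ?_ ?_ ?_ ?_
    all_goals simp only [Finset.card_empty, add_zero]
    all_goals omega
end
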